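/- arXiv:1904.12392 — 8 statements merged into one kernel-verified Lean document; each statement's English description precedes it below -/
import Mathlib

section
/- Let H be a nonzero finite-dimensional complex Hilbert space and A a unital *-subalgebra of the algebra of linear operators on H. Suppose there exist: a conjugate-linear bijection J : H → H with ⟨Jx, Jy⟩ = ⟨y, x⟩ for all x, y ∈ H and J² = 1; a self-adjoint unitary operator γ with γ² = 1 that commutes with every element of A and satisfies Jγ = -γJ; and a self-adjoint operator D with Dγ = -γD and DJ = JD. Assume the order-zero condition [a, J b* J⁻¹] = 0 holds for all a, b ∈ A. If (i) the only complex subspaces of H invariant under every element of A and under J are {0} and H, and (ii) A admits a separating vector, i.e. a vector ξ ∈ H such that aξ = 0 implies a = 0 for all a ∈ A, then there exists a positive integer N such that A is isomorphic as a complex *-algebra to M_N(ℂ) ⊕ M_N(ℂ). -/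
open scoped InnerProductSpace

namespace KO6

theorem burnside {V : Type*} [AddCommGroup V] [Module ℂ V] [FiniteDimensional ℂ V]
    [Nontrivial V] (S : Subalgebra ℂ (Module.End ℂ V))
    (hS : ∀ W : Submodule ℂ V, (∀ a ∈ S, ∀ x ∈ W, a x ∈ W) → W = ⊥ ∨ W = ⊤)
    (f : Module.End ℂ V) : f ∈ S := by
  have hsimple : IsSimpleModule S V := by
    refine { toIsSimpleOrder := { exists_pair_ne := exists_pair_ne _, eq_bot_or_eq_top := ?_ } }
    intro W
    have := hS (W.restrictScalars ℂ) (fun a ha x hx => W.smul_mem ⟨a, ha⟩ hx)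
    rcases this with h | h
    · left
      rw [Submodule.eq_bot_iff]
      intro x hx
      have : x ∈ W.restrictScalars ℂ := hx
      rw [h] at this
      simpa using this
    · right
      rw [Submodule.eq_top_iff']
      intro x
      have : x ∈ W.restrictScalars ℂ := by rw [h]; trivial
      exact this
  have hsch := (IsSimpleModule.algebraMap_end_bijective_of_isAlgClosed (A := S) (V := V) ℂ).2
  let F : Module.End (Module.End S V) V :=
    { toFun := f
      map_add' := f.map_add
      map_smul' := by
        intro g x
        obtain ⟨c, rfl⟩ := hsch g
        simp }
  classical
  let b := Module.finBasis ℂ V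
  obtain ⟨r, hr⟩ := jacobson_density (R := S) F (Finset.univ.image b)
  have : f = r.1 := by
    apply b.ext
    intro i
    exact hr (b i) (by simp)
  rw [this]
  exact r.2

variable {H : Type} [NormedAddCommGroup H] [InnerProductSpace ℂ H] [FiniteDimensional ℂ H]

structure Good (A : StarSubalgebra ℂ (H →ₗ[ℂ] H)) (J : H →ₛₗ[starRingEnd ℂ] H)
    (P M : Submodule ℂ H) : Prop where
  J2 : ∀ x, J (J x) = x
  comm : ∀ a ∈ A, ∀ b ∈ A, ∀ x, a (J (b (J x))) = J (b (J (a x)))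
  irr : ∀ W : Submodule ℂ H,
      (∀ a ∈ A, ∀ x ∈ W, a x ∈ W) → (∀ x ∈ W, J x ∈ W) → W = ⊥ ∨ W = ⊤
  disj : ∀ x ∈ P, x ∈ M → x = 0
  cod : ∀ x, ∃ p ∈ P, ∃ m ∈ M, x = p + m
  JP : ∀ x ∈ P, J x ∈ M
  JM : ∀ x ∈ M, J x ∈ P
  AP : ∀ a ∈ A, ∀ x ∈ P, a x ∈ P
  AM : ∀ a ∈ A, ∀ x ∈ M, a x ∈ M

structure Smp (A : StarSubalgebra ℂ (H →ₗ[ℂ] H)) (P V : Submodule ℂ H) : Prop where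
  le : V ≤ P
  ne : V ≠ ⊥
  inv : ∀ a ∈ A, ∀ x ∈ V, a x ∈ V
  smp : ∀ W : Submodule ℂ H, W ≤ V → (∀ a ∈ A, ∀ x ∈ W, a x ∈ W) → W = ⊥ ∨ W = V

variable {A : StarSubalgebra ℂ (H →ₗ[ℂ] H)} {J : H →ₛₗ[starRingEnd ℂ] H}
  {P M V V' : Submodule ℂ H}

theorem Good.symm (h : Good A J P M) : Good A J M P where
  J2 := h.J2
  comm := h.comm
  irr := h.irr
  disj := fun x hx hx' => h.disj x hx' hx
  cod := fun x => by
    obtain ⟨p, hp, m, hm, e⟩ := h.cod x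
    exact ⟨m, hm, p, hp, by rw [e, add_comm]⟩
  JP := h.JM
  JM := h.JP
  AP := h.AM
  AM := h.AP

theorem Good.Jinj (h : Good A J P M) {x : H} (hx : J x = 0) : x = 0 := by
  rw [← h.J2 x, hx, map_zero]

theorem Good.prim (h : Good A J P M) (U : Submodule ℂ H) (hU : U ≤ P) (hne : U ≠ ⊥)
    (h1 : ∀ a ∈ A, ∀ x ∈ U, a x ∈ U) (h2 : ∀ a ∈ A, ∀ x ∈ U, J (a (J x)) ∈ U) : P ≤ U := by
  let W : Submodule ℂ H :=
    { carrier := {x | ∃ u ∈ U, ∃ w ∈ U, x = u + J w}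
      add_mem' := by
        rintro _ _ ⟨u, hu, w, hw, rfl⟩ ⟨u', hu', w', hw', rfl⟩
        exact ⟨u + u', U.add_mem hu hu', w + w', U.add_mem hw hw', by rw [map_add]; abel⟩
      zero_mem' := ⟨0, U.zero_mem, 0, U.zero_mem, by simp⟩
      smul_mem' := by
        rintro c _ ⟨u, hu, w, hw, rfl⟩
        refine ⟨c • u, U.smul_mem _ hu, star c • w, U.smul_mem _ hw, ?_⟩
        rw [LinearMap.map_smulₛₗ]
        simp }
  have hW : W = ⊥ ∨ W = ⊤ := by
    apply h.irr
    · rintro a ha _ ⟨u, hu, w, hw, rfl⟩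
      refine ⟨a u, h1 a ha u hu, J (a (J w)), h2 a ha w hw, ?_⟩
      rw [h.J2, map_add]
    · rintro _ ⟨u, hu, w, hw, rfl⟩
      refine ⟨w, hw, u, hu, ?_⟩
      rw [map_add, h.J2, add_comm]
  rcases hW with hW | hW
  · exfalso
    apply hne
    rw [Submodule.eq_bot_iff]
    intro x hx
    have : x ∈ W := ⟨x, hx, 0, U.zero_mem, by simp⟩
    rw [hW] at this
    simpa using this
  · intro x hx
    have : x ∈ W := by rw [hW]; trivial
    obtain ⟨u, hu, w, hw, rfl⟩ := this
    have : J w = 0 := by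
      apply h.disj
      · have := P.sub_mem hx (hU hu)
        simpa using this
      · exact h.JP _ (hU hw)
    rw [this, add_zero]
    exact hu

theorem Good.opP (h : Good A J P M) {a : H →ₗ[ℂ] H} (ha : a ∈ A) {x : H} (hx : x ∈ P) :
    J (a (J x)) ∈ P := h.JM _ (h.AM _ ha _ (h.JP _ hx))

theorem Good.sep (h : Good A J P M) {x : H} (hx : x ∈ P) (hx0 : x ≠ 0)
    {a : H →ₗ[ℂ] H} (ha : a ∈ A) (hz : ∀ b ∈ A, a (b x) = 0) : ∀ y ∈ P, a y = 0 := by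
  let U : Submodule ℂ H :=
    { carrier := {y | y ∈ P ∧ ∀ b ∈ A, a (b y) = 0}
      add_mem' := by
        rintro y z ⟨hy, hy'⟩ ⟨hz, hz'⟩
        exact ⟨P.add_mem hy hz, fun b hb => by rw [map_add, map_add, hy' b hb, hz' b hb, add_zero]⟩
      zero_mem' := ⟨P.zero_mem, fun b hb => by simp⟩
      smul_mem' := by
        rintro c y ⟨hy, hy'⟩
        exact ⟨P.smul_mem _ hy, fun b hb => by rw [map_smul, map_smul, hy' b hb, smul_zero]⟩ }
  have : P ≤ U := by
    apply h.prim U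
    · exact fun y hy => hy.1
    · intro h0
      have : x ∈ U := ⟨hx, hz⟩
      rw [h0] at this
      exact hx0 (by simpa using this)
    · rintro c hc y ⟨hy, hy'⟩
      exact ⟨h.AP c hc y hy, fun b hb => hy' (b * c) (mul_mem hb hc)⟩
    · rintro c hc y ⟨hy, hy'⟩
      refine ⟨h.opP hc hy, fun b hb => ?_⟩
      rw [h.comm b hb c hc, h.comm a ha c hc, hy' b hb]
      simp
  intro y hy
  exact (this hy).2 1 (one_mem _)

theorem Good.faith (h : Good A J P M) (hV : Smp A P V) {a : H →ₗ[ℂ] H} (ha : a ∈ A)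
    (hz : ∀ x ∈ V, a x = 0) : ∀ y ∈ P, a y = 0 := by
  obtain ⟨x, hx, hx0⟩ := Submodule.exists_mem_ne_zero_of_ne_bot hV.ne
  exact h.sep (hV.le hx) hx0 ha (fun b hb => hz _ (hV.inv b hb x hx))

theorem Good.faithEq (h : Good A J P M) (hV : Smp A P V) {a b : H →ₗ[ℂ] H} (ha : a ∈ A)
    (hb : b ∈ A) (hz : ∀ x ∈ V, a x = b x) : ∀ y ∈ P, a y = b y := by
  intro y hy
  have := h.faith hV (sub_mem ha hb) (fun x hx => by simp [hz x hx]) y hy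
  simpa [sub_eq_zero] using this

theorem Good.ext (h : Good A J P M) {a b : H →ₗ[ℂ] H} (h1 : ∀ y ∈ P, a y = b y)
    (h2 : ∀ y ∈ M, a y = b y) : a = b := by
  ext x
  obtain ⟨p, hp, m, hm, rfl⟩ := h.cod x
  rw [map_add, map_add, h1 p hp, h2 m hm]

theorem Good.exists_simple (h : Good A J P M) (hP : P ≠ ⊥) : ∃ V, Smp A P V := by
  let s : Set (Submodule ℂ H) := {V | V ≤ P ∧ V ≠ ⊥ ∧ ∀ a ∈ A, ∀ x ∈ V, a x ∈ V}
  obtain ⟨V, ⟨h1, h2, h3⟩, hmin⟩ := WellFounded.has_min (wellFounded_lt (α := Submodule ℂ H)) s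
    ⟨P, le_rfl, hP, h.AP⟩
  refine ⟨V, h1, h2, h3, fun W hW hWA => ?_⟩
  by_contra hcon
  push Not at hcon
  exact hmin W ⟨hW.trans h1, hcon.1, hWA⟩ (lt_of_le_of_ne hW hcon.2)

/-- restriction as a star algebra hom -/
noncomputable def res (A : StarSubalgebra ℂ (H →ₗ[ℂ] H)) (V : Submodule ℂ H)
    (hV : ∀ a ∈ A, ∀ x ∈ V, a x ∈ V) : A →⋆ₐ[ℂ] (V →ₗ[ℂ] V) where
  toFun a := a.1.restrict (hV a.1 a.2)
  map_one' := by ext; rfl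
  map_mul' := fun a b => by ext; rfl
  map_zero' := by ext; rfl
  map_add' := fun a b => by ext; rfl
  commutes' := fun c => by ext; rfl
  map_star' := fun a => by
    rw [LinearMap.star_eq_adjoint, LinearMap.eq_adjoint_iff]
    intro x y
    change ⟪(star a.1) x.1, y.1⟫_ℂ = ⟪x.1, a.1 y.1⟫_ℂ
    rw [LinearMap.star_eq_adjoint, LinearMap.adjoint_inner_left]

theorem Smp.burn (hV : Smp A P V) (f : V →ₗ[ℂ] V) : ∃ a ∈ A, ∀ x : V, a x = f x := by
  have : Nontrivial V := Submodule.nontrivial_iff_ne_bot.2 hV.ne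
  have key := burnside (V := V) ((res A V hV.inv).toAlgHom.range) ?_ f
  · obtain ⟨a, ha⟩ := key
    refine ⟨a.1, a.2, fun x => ?_⟩
    rw [← ha]
    rfl
  · intro W hW
    have hinv : ∀ a ∈ A, ∀ x ∈ W.map V.subtype, a x ∈ W.map V.subtype := by
      rintro a ha _ ⟨x, hx, rfl⟩
      exact ⟨_, hW (res A V hV.inv ⟨a, ha⟩) ⟨⟨a, ha⟩, rfl⟩ x hx, rfl⟩
    rcases hV.smp (W.map V.subtype) (Submodule.map_subtype_le V W) hinv with h | h
    · left
      rw [Submodule.eq_bot_iff]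
      intro x hx
      have : x.1 ∈ W.map V.subtype := ⟨x, hx, rfl⟩
      rw [h] at this
      exact Subtype.ext ((Submodule.mem_bot ℂ).1 this)
    · right
      rw [Submodule.eq_top_iff']
      intro x
      have : x.1 ∈ W.map V.subtype := by rw [h]; exact x.2
      obtain ⟨y, hy, hyx⟩ := this
      have : y = x := Subtype.ext hyx
      rwa [← this]

/-- rank one operators -/
theorem Smp.rk (hV : Smp A P V) {u v : H} (hv : v ∈ V) :
    ∃ a ∈ A, ∀ x ∈ V, a x = ⟪u, x⟫_ℂ • v := by
  obtain ⟨a, ha, hax⟩ := hV.burn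
    (((innerSL ℂ u).toLinearMap.comp V.subtype).smulRight (⟨v, hv⟩ : V))
  exact ⟨a, ha, fun x hx => by simpa using hax ⟨x, hx⟩⟩

theorem Smp.unit (hV : Smp A P V) : ∃ u ∈ V, ⟪u, u⟫_ℂ = 1 := by
  obtain ⟨x, hx, hx0⟩ := Submodule.exists_mem_ne_zero_of_ne_bot hV.ne
  refine ⟨((‖x‖ : ℂ)⁻¹) • x, V.smul_mem _ hx, ?_⟩
  rw [inner_self_eq_norm_sq_to_K, norm_smul]
  have : ‖x‖ ≠ 0 := norm_ne_zero_iff.2 hx0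
  simp [this]

theorem indep (h1 : Smp A P V) (h2 : Smp A M V') {e : H →ₗ[ℂ] H} (he : e ∈ A)
    (he2 : ∀ x ∈ V', e x = 0) {x0 : H} (hx0 : x0 ∈ V) (hex : e x0 ≠ 0) (f : V →ₗ[ℂ] V) :
    ∃ a ∈ A, (∀ x : V, a x = f x) ∧ ∀ x ∈ V', a x = 0 := by
  let b := stdOrthonormalBasis ℂ V
  choose p hp hp' using fun i => h1.rk (u := (b i : H)) hx0
  choose q hq hq' using fun i => h1.rk (u := e x0) (f (b i)).2
  have hn : ⟪e x0, e x0⟫_ℂ ≠ 0 := inner_self_ne_zero.2 hex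
  refine ⟨(⟪e x0, e x0⟫_ℂ)⁻¹ • ∑ i, q i * (e * p i), ?_, ?_, ?_⟩
  · exact A.smul_mem (sum_mem fun i _ => mul_mem (hq i) (mul_mem he (hp i))) _
  · intro x
    have hx : f x = ∑ i, ⟪b i, x⟫_ℂ • f (b i) := by
      conv_lhs => rw [← b.sum_repr' x]
      simp
    rw [hx]
    simp only [LinearMap.smul_apply, LinearMap.sum_apply, Module.End.mul_apply, hp' _ _ x.2,
      map_smul, hq' _ _ (h1.inv e he _ hx0)]
    simp only [Submodule.coe_sum, Submodule.coe_smul, Finset.smul_sum]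
    refine Finset.sum_congr rfl fun i _ => ?_
    rw [smul_comm, smul_smul (⟪e x0, e x0⟫_ℂ)⁻¹, inv_mul_cancel₀ hn, one_smul]
    rfl
  · intro x hx
    simp only [LinearMap.smul_apply, LinearMap.sum_apply, Module.End.mul_apply]
    rw [Finset.sum_eq_zero, smul_zero]
    intro i _
    rw [he2 _ (h2.inv _ (hp i) _ hx), map_zero]

theorem Good.vec (h : Good A J P M) {e f : H →ₗ[ℂ] H} (he : e ∈ A) (hf : f ∈ A)
    (hee : ∀ x ∈ P, e (e x) = e x) (he0 : ∃ x ∈ P, e x ≠ 0) {w : H} (hw : w ∈ M) (hw0 : w ≠ 0)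
    (hfw : f w = w) : ∃ v ∈ P, v ≠ 0 ∧ e v = v ∧ J (f (J v)) = v := by
  have hx : J w ∈ P := h.JM w hw
  have hx0 : J w ≠ 0 := fun h0 => hw0 (h.Jinj h0)
  by_cases hz : ∀ b ∈ A, e (b (J w)) = 0
  · obtain ⟨x, hx', hne⟩ := he0
    exact absurd (h.sep hx hx0 he hz x hx') hne
  · push Not at hz
    obtain ⟨b, hb, hne⟩ := hz
    refine ⟨e (b (J w)), h.AP _ he _ (h.AP _ hb _ hx), hne, hee _ (h.AP _ hb _ hx), ?_⟩
    rw [← h.comm e he f hf, ← h.comm b hb f hf, h.J2, hfw]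

theorem Good.span (h : Good A J P M) {v : H} (hv : v ∈ P) (hv0 : v ≠ 0) (W : Submodule ℂ H)
    (hW : ∀ a ∈ A, ∀ b ∈ A, a (J (b (J v))) ∈ W) : P ≤ W := by
  let U : Submodule ℂ H := Submodule.span ℂ {x | ∃ a ∈ A, ∃ b ∈ A, x = a (J (b (J v)))}
  have hUW : U ≤ W := Submodule.span_le.2 (by rintro _ ⟨a, ha, b, hb, rfl⟩; exact hW a ha b hb)
  refine le_trans (h.prim U ?_ ?_ ?_ ?_) hUW
  · refine Submodule.span_le.2 ?_
    rintro _ ⟨a, ha, b, hb, rfl⟩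
    exact h.AP a ha _ (h.opP hb hv)
  · intro h0
    have : v ∈ U := Submodule.subset_span ⟨1, one_mem _, 1, one_mem _, by simp [h.J2]⟩
    rw [h0] at this
    exact hv0 (by simpa using this)
  · intro c hc x hx
    induction hx using Submodule.span_induction with
    | mem x hx =>
      obtain ⟨a, ha, b, hb, rfl⟩ := hx
      exact Submodule.subset_span ⟨c * a, mul_mem hc ha, b, hb, rfl⟩
    | zero => simp
    | add x y _ _ hx hy => rw [map_add]; exact U.add_mem hx hy
    | smul k x _ hx => rw [map_smul]; exact U.smul_mem _ hx
  · intro c hc x hx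
    induction hx using Submodule.span_induction with
    | mem x hx =>
      obtain ⟨a, ha, b, hb, rfl⟩ := hx
      refine Submodule.subset_span ⟨a, ha, c * b, mul_mem hc hb, ?_⟩
      rw [← h.comm a ha c hc, h.J2]
      rfl
    | zero => simp
    | add x y _ _ hx hy => rw [map_add, map_add, map_add]; exact U.add_mem hx hy
    | smul k x _ hx =>
      rw [LinearMap.map_smulₛₗ, map_smul, LinearMap.map_smulₛₗ]; exact U.smul_mem _ hx

theorem Good.dim_le (h : Good A J P M) (h1 : Smp A P V) (h2 : Smp A M V') :
    Module.finrank ℂ P ≤ Module.finrank ℂ V * Module.finrank ℂ V' := by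
  obtain ⟨u, hu, huu⟩ := h1.unit
  obtain ⟨w, hw, hww⟩ := h2.unit
  obtain ⟨e, he, he'⟩ := h1.rk (u := u) hu
  obtain ⟨f, hf, hf'⟩ := h2.rk (u := w) hw
  have hu0 : u ≠ 0 := by rintro rfl; simp at huu
  have hw0 : w ≠ 0 := by rintro rfl; simp at hww
  have heu : e u = u := by rw [he' u hu, huu, one_smul]
  have hfw : f w = w := by rw [hf' w hw, hww, one_smul]
  obtain ⟨v, hv, hv0, hev, hfv⟩ := h.vec he hf
    (h.faithEq h1 (mul_mem he he) he (fun x hx => by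
      rw [Module.End.mul_apply, he' x hx, map_smul, heu])) ⟨u, h1.le hu, by rwa [heu]⟩
    (h2.le hw) hw0 hfw
  have hfJv : f (J v) = J v := by rw [← h.J2 (f (J v)), hfv]
  let b := stdOrthonormalBasis ℂ V
  let b' := stdOrthonormalBasis ℂ V'
  choose p hp hp' using fun i => h1.rk (u := u) (b i).2
  choose q hq hq' using fun i => h2.rk (u := w) (b' i).2
  let g : Fin (Module.finrank ℂ V) × Fin (Module.finrank ℂ V') → H :=
    fun ij => p ij.1 (J (q ij.2 (J v)))
  have hle : P ≤ Submodule.span ℂ (Set.range g) := by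
    apply h.span hv hv0
    intro a ha c hc
    have hA : ∀ x ∈ P, (a * e) x = (∑ i, ⟪b i, (⟨a u, h1.inv a ha u hu⟩ : V)⟫_ℂ • p i) x := by
      apply h.faithEq h1 (mul_mem ha he) (sum_mem fun i _ => A.smul_mem (hp i) _)
      intro x hx
      have := congrArg Subtype.val (b.sum_repr' (⟨a u, h1.inv a ha u hu⟩ : V))
      simp only [Submodule.coe_sum, Submodule.coe_smul] at this
      rw [Module.End.mul_apply, he' x hx, map_smul]
      refine (congrArg (fun z => ⟪u, x⟫_ℂ • z) this.symm).trans ?_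
      simp only [LinearMap.sum_apply, LinearMap.smul_apply, hp' _ _ hx, Finset.smul_sum]
      exact Finset.sum_congr rfl fun i _ => smul_comm _ _ _
    have hC : ∀ x ∈ M, (c * f) x = (∑ i, ⟪b' i, (⟨c w, h2.inv c hc w hw⟩ : V')⟫_ℂ • q i) x := by
      apply h.symm.faithEq h2 (mul_mem hc hf) (sum_mem fun i _ => A.smul_mem (hq i) _)
      intro x hx
      have := congrArg Subtype.val (b'.sum_repr' (⟨c w, h2.inv c hc w hw⟩ : V'))
      simp only [Submodule.coe_sum, Submodule.coe_smul] at this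
      rw [Module.End.mul_apply, hf' x hx, map_smul]
      refine (congrArg (fun z => ⟪w, x⟫_ℂ • z) this.symm).trans ?_
      simp only [LinearMap.sum_apply, LinearMap.smul_apply, hq' _ _ hx, Finset.smul_sum]
      exact Finset.sum_congr rfl fun i _ => smul_comm _ _ _
    have e1 : a v = ∑ i, ⟪b i, (⟨a u, h1.inv a ha u hu⟩ : V)⟫_ℂ • p i v := by
      have := hA v hv
      rw [Module.End.mul_apply, hev] at this
      rw [this]; simp
    have e2 : c (J v) = ∑ i, ⟪b' i, (⟨c w, h2.inv c hc w hw⟩ : V')⟫_ℂ • q i (J v) := by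
      have := hC (J v) (h.JP v hv)
      rw [Module.End.mul_apply, hfJv] at this
      rw [this]; simp
    rw [h.comm a ha c hc, e1]
    simp only [map_sum, LinearMap.map_smulₛₗ, RingHom.id_apply]
    refine sum_mem fun i _ => Submodule.smul_mem _ _ ?_
    rw [← h.comm (p i) (hp i) c hc, e2]
    simp only [map_sum, LinearMap.map_smulₛₗ, RingHom.id_apply]
    refine sum_mem fun j _ => Submodule.smul_mem _ _ ?_
    exact Submodule.subset_span ⟨(i, j), rfl⟩
  calc Module.finrank ℂ P ≤ Module.finrank ℂ (Submodule.span ℂ (Set.range g)) :=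
        Submodule.finrank_mono hle
    _ ≤ Fintype.card (Fin (Module.finrank ℂ V) × Fin (Module.finrank ℂ V')) :=
        finrank_range_le_card g
    _ = _ := by simp

theorem Good.dim_ge (h : Good A J P M) (h1 : Smp A P V) (h2 : Smp A M V')
    (hs : ∃ ξ : H, ∀ a ∈ A, a ξ = 0 → a = (0 : H →ₗ[ℂ] H))
    (hsur : ∀ f : V →ₗ[ℂ] V, ∃ a ∈ A, (∀ x : V, a x = f x) ∧ ∀ x ∈ V', a x = 0) :
    Module.finrank ℂ V * Module.finrank ℂ V ≤ Module.finrank ℂ P := by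
  obtain ⟨ξ, hξ⟩ := hs
  let K : Submodule ℂ A :=
    { carrier := {a | ∀ x ∈ V', a.1 x = 0}
      add_mem' := by
        intro a b ha hb x hx
        change a.1 x + b.1 x = 0
        rw [ha x hx, hb x hx, add_zero]
      zero_mem' := fun x _ => rfl
      smul_mem' := by
        intro c a ha x hx
        change c • a.1 x = 0
        rw [ha x hx, smul_zero] }
  let r : K →ₗ[ℂ] (V →ₗ[ℂ] V) := (res A V h1.inv).toAlgHom.toLinearMap.comp K.subtype
  have hr : Function.Surjective r := by
    intro f
    obtain ⟨a, ha, haf, ha0⟩ := hsur f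
    refine ⟨⟨⟨a, ha⟩, ha0⟩, ?_⟩
    ext x
    exact haf x
  have hKP : ∀ k : K, k.1.1 ξ ∈ P := by
    intro k
    obtain ⟨p, hp, m, hm, e⟩ := h.cod ξ
    rw [e, map_add, h.symm.faith h2 k.1.2 k.2 m hm, add_zero]
    exact h.AP _ k.1.2 _ hp
  let t : K →ₗ[ℂ] P :=
    { toFun := fun k => ⟨k.1.1 ξ, hKP k⟩
      map_add' := fun k l => rfl
      map_smul' := fun c k => rfl }
  have ht : Function.Injective t := by
    rw [injective_iff_map_eq_zero]
    intro k hk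
    have := hξ k.1.1 k.1.2 (congrArg Subtype.val hk)
    exact Subtype.ext (Subtype.ext this)
  have : FiniteDimensional ℂ K := FiniteDimensional.of_injective t ht
  calc _ = Module.finrank ℂ (V →ₗ[ℂ] V) := (Module.finrank_linearMap ℂ ℂ V V).symm
    _ ≤ Module.finrank ℂ K := LinearMap.finrank_le_finrank_of_surjective hr
    _ ≤ _ := LinearMap.finrank_le_finrank_of_injective ht

theorem Good.not_simple (h : Good A J P M) (h1 : Smp A P V)
    (hP : ∀ a ∈ A, (∀ x ∈ P, a x = 0) → a = 0) (hM : ∀ a ∈ A, (∀ x ∈ M, a x = 0) → a = 0) :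
    False := by
  obtain ⟨u, hu, huu⟩ := h1.unit
  obtain ⟨e, he, he'⟩ := h1.rk (u := u) hu
  have hu0 : u ≠ 0 := by rintro rfl; simp at huu
  have heu : e u = u := by rw [he' u hu, huu, one_smul]
  have hext : ∀ a ∈ A, ∀ b ∈ A, (∀ x ∈ V, a x = b x) → a = b := by
    intro a ha b hb hab
    have := hP (a - b) (sub_mem ha hb) (h.faith h1 (sub_mem ha hb) fun x hx => by simp [hab x hx])
    exact sub_eq_zero.1 this
  have hee : e * e = e := hext _ (mul_mem he he) _ he (fun x hx => by
      rw [Module.End.mul_apply, he' x hx, map_smul, heu])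
  have hea : ∀ a ∈ A, ∃ c : ℂ, ∀ x, e (a (e x)) = c • e x := by
    intro a ha
    refine ⟨⟪u, a u⟫_ℂ, fun x => ?_⟩
    have := hext (e * (a * e)) (mul_mem he (mul_mem ha he)) (⟪u, a u⟫_ℂ • e) (A.smul_mem he _)
      (fun x hx => by
        simp only [Module.End.mul_apply, LinearMap.smul_apply, he' x hx, map_smul,
          he' _ (h1.inv a ha u hu)]
        exact smul_comm _ _ _)
    exact congrArg (fun g : H →ₗ[ℂ] H => g x) this
  have hee' : ∀ x, e (e x) = e x := fun x => congrArg (fun g : H →ₗ[ℂ] H => g x) hee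
  have hm : ∃ m ∈ M, e m ≠ 0 := by
    by_contra hcon
    push Not at hcon
    have := hM e he hcon
    rw [this] at heu
    exact hu0 heu.symm
  obtain ⟨m, hm, hem⟩ := hm
  obtain ⟨v, hv, hv0, hev, hJv⟩ := h.vec he he (fun x _ => hee' x) ⟨u, h1.le hu, by rwa [heu]⟩
    (h.AM e he m hm) hem (hee' m)
  have hevJ : e (J v) = J v := by rw [← h.J2 (e (J v)), hJv]
  have hw : e (v + J v) = v + J v := by rw [map_add, hev, hevJ]
  have hJw : J (v + J v) = v + J v := by rw [map_add, h.J2, add_comm]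
  generalize hwdef : v + J v = w at hw hJw
  have hw0 : w ≠ 0 := by
    rintro rfl
    apply hv0
    apply h.disj v hv
    rw [eq_neg_of_add_eq_zero_left hwdef]
    exact M.neg_mem (h.JP v hv)
  let U : Submodule ℂ H := Submodule.span ℂ {x | ∃ a ∈ A, ∃ b ∈ A, x = a (J (b w))}
  have hU : U = ⊤ := by
    refine (h.irr U ?_ ?_).resolve_left ?_
    · intro c hc x hx
      induction hx using Submodule.span_induction with
      | mem x hx =>
        obtain ⟨a, ha, b, hb, rfl⟩ := hx
        exact Submodule.subset_span ⟨c * a, mul_mem hc ha, b, hb, rfl⟩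
      | zero => simp
      | add x y _ _ hx hy => rw [map_add]; exact U.add_mem hx hy
      | smul k x _ hx => rw [map_smul]; exact U.smul_mem _ hx
    · intro x hx
      induction hx using Submodule.span_induction with
      | mem x hx =>
        obtain ⟨a, ha, b, hb, rfl⟩ := hx
        refine Submodule.subset_span ⟨b, hb, a, ha, ?_⟩
        have := h.comm b hb a ha w
        rw [hJw] at this
        exact this.symm
      | zero => simp
      | add x y _ _ hx hy => rw [map_add]; exact U.add_mem hx hy
      | smul k x _ hx => rw [LinearMap.map_smulₛₗ]; exact U.smul_mem _ hx
    · intro h0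
      have : w ∈ U := Submodule.subset_span ⟨1, one_mem _, 1, one_mem _, by simp [hJw]⟩
      rw [h0] at this
      exact hw0 (by simpa using this)
  have hscal : ∀ z ∈ U, ∃ c : ℂ, e (J (e (J z))) = c • w := by
    intro z hz
    induction hz using Submodule.span_induction with
    | mem x hx =>
      obtain ⟨a, ha, b, hb, rfl⟩ := hx
      obtain ⟨c, hc⟩ := hea a ha
      obtain ⟨d, hd⟩ := hea b hb
      have hJew : J (e (J w)) = w := by rw [hJw, hw, hJw]
      -- e JeJ a J b w = e a J e b w = e a J e b e w
      have s1 : J (e (J (a (J (b w))))) = a (J (e (b w))) := by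
        rw [← h.comm a ha e he, h.J2]
      have s2 : e (b w) = d • w := by
        have := hd w
        rwa [hw] at this
      have s3 : e (a w) = c • w := by
        have := hc w
        rwa [hw] at this
      refine ⟨(starRingEnd ℂ d) * c, ?_⟩
      rw [s1, s2, LinearMap.map_smulₛₗ, hJw, map_smul, map_smul, s3, smul_smul]
    | zero => exact ⟨0, by simp⟩
    | add x y _ _ hx hy =>
      obtain ⟨c, hc⟩ := hx
      obtain ⟨d, hd⟩ := hy
      exact ⟨c + d, by simp only [map_add, hc, hd, add_smul]⟩
    | smul k x _ hx =>
      obtain ⟨c, hc⟩ := hx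
      exact ⟨k * c, by simp only [LinearMap.map_smulₛₗ, map_smul, hc, mul_smul]; simp⟩
  obtain ⟨c, hc⟩ := hscal v (by rw [hU]; trivial)
  rw [hJv, hev, ← hwdef, smul_add] at hc
  have hz : c • J v = 0 := by
    apply h.disj
    · have : c • J v = v - c • v := by rw [eq_sub_iff_add_eq, add_comm]; exact hc.symm
      rw [this]
      exact P.sub_mem hv (P.smul_mem _ hv)
    · exact M.smul_mem _ (h.JP v hv)
  rw [hz, add_zero] at hc
  rcases smul_eq_zero.1 hz with h0 | h0
  · rw [h0, zero_smul] at hc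
    exact hv0 hc
  · exact hv0 (h.Jinj h0)

theorem Good.main (h : Good A J P M) (hP0 : P ≠ ⊥) (hM0 : M ≠ ⊥)
    (hs : ∃ ξ : H, ∀ a ∈ A, a ξ = 0 → a = (0 : H →ₗ[ℂ] H)) :
    ∃ N : ℕ, 0 < N ∧
      Nonempty (A ≃⋆ₐ[ℂ] (Matrix (Fin N) (Fin N) ℂ × Matrix (Fin N) (Fin N) ℂ)) := by
  obtain ⟨V, h1⟩ := h.exists_simple hP0
  obtain ⟨V', h2⟩ := h.symm.exists_simple hM0
  have hcase : (∃ e ∈ A, (∀ x ∈ V', e x = 0) ∧ ∃ x ∈ V, e x ≠ 0) ∨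
      (∃ e ∈ A, (∀ x ∈ V, e x = 0) ∧ ∃ x ∈ V', e x ≠ 0) := by
    by_contra hcon
    push Not at hcon
    obtain ⟨c1, c2⟩ := hcon
    refine h.not_simple h1 (fun a ha hz => ?_) (fun a ha hz => ?_)
    · refine h.ext hz (h.symm.faith h2 ha (c2 a ha fun x hx => hz x (h1.le hx)))
    · refine h.ext (h.faith h1 ha (c1 a ha fun x hx => hz x (h2.le hx))) hz
  have hsur : (∀ f : V →ₗ[ℂ] V, ∃ a ∈ A, (∀ x : V, a x = f x) ∧ ∀ x ∈ V', a x = 0) ∧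
      (∀ f : V' →ₗ[ℂ] V', ∃ a ∈ A, (∀ x : V', a x = f x) ∧ ∀ x ∈ V, a x = 0) := by
    have aux : ∀ {P M V V' : Submodule ℂ H}, Smp A P V → Smp A M V' →
        (∀ f : V →ₗ[ℂ] V, ∃ a ∈ A, (∀ x : V, a x = f x) ∧ ∀ x ∈ V', a x = 0) →
        (∀ f : V' →ₗ[ℂ] V', ∃ a ∈ A, (∀ x : V', a x = f x) ∧ ∀ x ∈ V, a x = 0) := by
      intro P M V V' h1 h2 hs f
      obtain ⟨a, ha, haf⟩ := h2.burn f
      obtain ⟨b, hb, hba, hb0⟩ := hs (res A V h1.inv ⟨a, ha⟩)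
      refine ⟨a - b, sub_mem ha hb, fun x => ?_, fun x hx => ?_⟩
      · rw [LinearMap.sub_apply, hb0 x x.2, haf, sub_zero]
      · have : b x = a x := hba ⟨x, hx⟩
        rw [LinearMap.sub_apply, this, sub_self]
    rcases hcase with ⟨e, he, he0, x, hx, hex⟩ | ⟨e, he, he0, x, hx, hex⟩
    · have := indep h1 h2 he he0 hx hex
      exact ⟨this, aux h1 h2 this⟩
    · have := indep h2 h1 he he0 hx hex
      exact ⟨aux h2 h1 this, this⟩
  have hpos1 : 0 < Module.finrank ℂ V :=
    Nat.pos_of_ne_zero fun h0 => h1.ne (Submodule.finrank_eq_zero.1 h0)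
  have hpos2 : 0 < Module.finrank ℂ V' :=
    Nat.pos_of_ne_zero fun h0 => h2.ne (Submodule.finrank_eq_zero.1 h0)
  have hdim : Module.finrank ℂ V' = Module.finrank ℂ V := by
    have d1 := (h.dim_ge h1 h2 hs hsur.1).trans (h.dim_le h1 h2)
    have d2 := (h.symm.dim_ge h2 h1 hs hsur.2).trans (h.symm.dim_le h2 h1)
    exact le_antisymm (Nat.le_of_mul_le_mul_left d2 hpos2) (Nat.le_of_mul_le_mul_left d1 hpos1)
  refine ⟨Module.finrank ℂ V, hpos1, ?_⟩
  let E1 := LinearMap.toMatrixOrthonormal (stdOrthonormalBasis ℂ V)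
  let E2 := LinearMap.toMatrixOrthonormal ((stdOrthonormalBasis ℂ V').reindex (finCongr hdim))
  let F : A →⋆ₐ[ℂ] ((V →ₗ[ℂ] V) × (V' →ₗ[ℂ] V')) := (res A V h1.inv).prod (res A V' h2.inv)
  have hF : Function.Bijective F := by
    constructor
    · rw [injective_iff_map_eq_zero]
      intro a ha
      have a1 : res A V h1.inv a = 0 := congrArg Prod.fst ha
      have a2 : res A V' h2.inv a = 0 := congrArg Prod.snd ha
      apply Subtype.ext
      apply h.ext
      · exact h.faith h1 a.2 fun x hx =>
          congrArg Subtype.val (congrArg (fun g : V →ₗ[ℂ] V => g ⟨x, hx⟩) a1)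
      · exact h.symm.faith h2 a.2 fun x hx =>
          congrArg Subtype.val (congrArg (fun g : V' →ₗ[ℂ] V' => g ⟨x, hx⟩) a2)
    · rintro ⟨f, g⟩
      obtain ⟨a, ha, haf, ha0⟩ := hsur.1 f
      obtain ⟨b, hb, hbg, hb0⟩ := hsur.2 g
      refine ⟨⟨a + b, add_mem ha hb⟩, Prod.ext ?_ ?_⟩
      · ext x
        change a x + b x = f x
        rw [haf, hb0 x x.2, add_zero]
      · ext x
        change a x + b x = g x
        rw [hbg, ha0 x x.2, zero_add]
  let G : ((V →ₗ[ℂ] V) × (V' →ₗ[ℂ] V')) ≃⋆ₐ[ℂ] (Matrix (Fin (Module.finrank ℂ V))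
      (Fin (Module.finrank ℂ V)) ℂ × Matrix (Fin (Module.finrank ℂ V))
      (Fin (Module.finrank ℂ V)) ℂ) :=
    { toFun := fun x => (E1 x.1, E2 x.2)
      invFun := fun x => (E1.symm x.1, E2.symm x.2)
      left_inv := fun x => by simp
      right_inv := fun x => by simp
      map_mul' := fun x y => by simp
      map_add' := fun x y => by simp
      map_star' := fun x => Prod.ext (map_star E1 x.1) (map_star E2 x.2)
      map_smul' := fun c x => Prod.ext (map_smul E1 c x.1) (map_smul E2 c x.2) }
  exact ⟨(StarAlgEquiv.ofBijective F hF).trans G⟩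

end KO6

/-- Classification of irreducible finite real spectral triples of
KO-dimension 6: if `(A, H, D; J, γ)` is a finite real spectral triple of
KO-dimension 6 (so `J² = 1`, `JD = DJ`, `Jγ = -γJ`) which is irreducible
(the joint representation of `A` and `J` has no nontrivial invariant
subspace, and `A` has a separating vector), then `A ≅ M_N(ℂ) ⊕ M_N(ℂ)` as a
complex *-algebra, for some positive integer `N`. -/
theorem stmt_0 {H : Type} [NormedAddCommGroup H] [InnerProductSpace ℂ H]
    [FiniteDimensional ℂ H] [Nontrivial H]
    (A : StarSubalgebra ℂ (H →ₗ[ℂ] H))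
    (J : H → H)
    (hJadd : ∀ x y, J (x + y) = J x + J y)
    (hJsmul : ∀ (c : ℂ) (x : H), J (c • x) = star c • J x)
    (hJbij : Function.Bijective J)
    (hJinner : ∀ x y : H, ⟪J x, J y⟫_ℂ = ⟪y, x⟫_ℂ)
    (hJ2 : ∀ x, J (J x) = x)
    (γ : H →ₗ[ℂ] H)
    (hγsa : LinearMap.adjoint γ = γ)
    (hγunitary : γ ∘ₗ γ = LinearMap.id)
    (hγA : ∀ a ∈ A, γ ∘ₗ a = a ∘ₗ γ)
    (hJγ : ∀ x, J (γ x) = - γ (J x))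
    (D : H →ₗ[ℂ] H)
    (hDsa : LinearMap.adjoint D = D)
    (hDγ : D ∘ₗ γ = - (γ ∘ₗ D))
    (hDJ : ∀ x, D (J x) = J (D x))
    (horder0 : ∀ a ∈ A, ∀ b ∈ A, ∀ x : H,
      a (J ((star b) (J x))) = J ((star b) (J (a x))))
    (hirr : ∀ W : Submodule ℂ H,
      (∀ a ∈ A, ∀ x ∈ W, a x ∈ W) → (∀ x ∈ W, J x ∈ W) → W = ⊥ ∨ W = ⊤)
    (hsep : ∃ ξ : H, ∀ a ∈ A, a ξ = 0 → a = (0 : H →ₗ[ℂ] H)) :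
    ∃ N : ℕ, 0 < N ∧
      Nonempty (A ≃⋆ₐ[ℂ] (Matrix (Fin N) (Fin N) ℂ × Matrix (Fin N) (Fin N) ℂ)) := by
  let Jl : H →ₛₗ[starRingEnd ℂ] H :=
    { toFun := J
      map_add' := hJadd
      map_smul' := hJsmul }
  have hγ2 : ∀ x, γ (γ x) = x := fun x => congrArg (fun g : H →ₗ[ℂ] H => g x) hγunitary
  have hJn : ∀ x, J (-x) = - J x := fun x => map_neg Jl x
  let P : Submodule ℂ H := LinearMap.ker (γ - LinearMap.id)
  let M : Submodule ℂ H := LinearMap.ker (γ + LinearMap.id)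
  have hPm : ∀ x, x ∈ P ↔ γ x = x := fun x => by simp [P, sub_eq_zero]
  have hMm : ∀ x, x ∈ M ↔ γ x = -x := fun x => by simp [M, add_eq_zero_iff_eq_neg]
  have hJP : ∀ x ∈ P, J x ∈ M := fun x hx => by
    rw [hMm, ← neg_eq_iff_eq_neg]
    have := hJγ x
    rw [(hPm x).1 hx] at this
    exact this.symm
  have hJM : ∀ x ∈ M, J x ∈ P := fun x hx => by
    rw [hPm]
    have := hJγ x
    rw [(hMm x).1 hx, hJn] at this
    exact (neg_injective this).symm
  have hγa : ∀ a ∈ A, ∀ x, γ (a x) = a (γ x) := fun a ha x =>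
    congrArg (fun g : H →ₗ[ℂ] H => g x) (hγA a ha)
  have hcod : ∀ x, ∃ p ∈ P, ∃ m ∈ M, x = p + m := fun x => by
    refine ⟨(2⁻¹ : ℂ) • (x + γ x), ?_, (2⁻¹ : ℂ) • (x - γ x), ?_, ?_⟩
    · rw [hPm, map_smul, map_add, hγ2, add_comm]
    · rw [hMm, map_smul, map_sub, hγ2, ← smul_neg, neg_sub]
    · rw [← smul_add, add_add_sub_cancel, ← two_smul ℂ x, smul_smul]
      simp
  have good : KO6.Good A Jl P M :=
    { J2 := hJ2
      comm := fun a ha b hb x => by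
        have := horder0 a ha (star b) (star_mem hb) x
        rwa [star_star] at this
      irr := hirr
      disj := fun x h1 h2 => by
        have e1 := (hPm x).1 h1
        rw [(hMm x).1 h2] at e1
        have e2 : (2 : ℂ) • x = 0 := by
          rw [two_smul]
          nth_rewrite 1 [← e1]
          exact neg_add_cancel x
        exact (smul_eq_zero.1 e2).resolve_left two_ne_zero
      cod := hcod
      JP := hJP
      JM := hJM
      AP := fun a ha x hx => by rw [hPm, hγa a ha, (hPm x).1 hx]
      AM := fun a ha x hx => by rw [hMm, hγa a ha, (hMm x).1 hx, map_neg] }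
  have hPM : P = ⊥ ↔ M = ⊥ := by
    constructor
    · intro h0
      rw [Submodule.eq_bot_iff]
      intro x hx
      have := hJM x hx
      rw [h0] at this
      exact good.Jinj ((Submodule.mem_bot ℂ).1 this)
    · intro h0
      rw [Submodule.eq_bot_iff]
      intro x hx
      have := hJP x hx
      rw [h0] at this
      exact good.Jinj ((Submodule.mem_bot ℂ).1 this)
  have hP0 : P ≠ ⊥ := by
    intro h0
    have h0' := hPM.1 h0
    obtain ⟨x, hx⟩ := exists_ne (0 : H)
    obtain ⟨p, hp, m, hm, rfl⟩ := hcod x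
    rw [h0] at hp
    rw [h0'] at hm
    apply hx
    rw [(Submodule.mem_bot ℂ).1 hp, (Submodule.mem_bot ℂ).1 hm, add_zero]
  exact good.main hP0 (fun h => hP0 (hPM.2 h)) hsep
end

section
/- Let n and m be positive integers, and let the *-algebra A = M_n(ℂ) ⊕ M_m(ℂ) act on the complex Hilbert space H = M_{n×m}(ℂ) ⊕ M_{m×n}(ℂ) by π(x, y)(M, N) = (xM, yN). Then A admits a separating vector — i.e. there exists ξ ∈ H such that π(a)ξ = 0 implies a = 0 for all a ∈ A — if and only if n = m. -/
lemma aux_le (n m : ℕ) (hn : 0 < n) (M : Matrix (Fin n) (Fin m) ℂ)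
    (h : ∀ x : Matrix (Fin n) (Fin n) ℂ, x * M = 0 → x = 0) : n ≤ m := by
  let f : Matrix (Fin n) (Fin n) ℂ →ₗ[ℂ] Matrix (Fin n) (Fin m) ℂ :=
    { toFun := fun x => x * M
      map_add' := fun x y => Matrix.add_mul x y M
      map_smul' := fun c x => Matrix.smul_mul c x M }
  have hf : Function.Injective f := (injective_iff_map_eq_zero f).2 h
  have h1 := LinearMap.finrank_le_finrank_of_injective hf
  simp only [Module.finrank_matrix, Fintype.card_fin, Module.finrank_self, mul_one] at h1
  exact Nat.le_of_mul_le_mul_left h1 hn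

/-- The *-algebra `M_n(ℂ) ⊕ M_m(ℂ)` acting on `M_{n×m}(ℂ) ⊕ M_{m×n}(ℂ)` by
`π(x, y)(M, N) = (xM, yN)` admits a separating vector if and only if `n = m`. -/
theorem stmt_1 (n m : ℕ) (hn : 0 < n) (hm : 0 < m) :
    (∃ ξ : Matrix (Fin n) (Fin m) ℂ × Matrix (Fin m) (Fin n) ℂ,
      ∀ a : Matrix (Fin n) (Fin n) ℂ × Matrix (Fin m) (Fin m) ℂ,
        (a.1 * ξ.1, a.2 * ξ.2) = (0, 0) → a = 0) ↔ n = m := by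
  constructor
  · rintro ⟨ξ, h⟩
    apply le_antisymm
    · refine aux_le n m hn ξ.1 fun x hx => ?_
      exact congrArg Prod.fst (h (x, 0) (by simp [hx]))
    · refine aux_le m n hm ξ.2 fun x hx => ?_
      exact congrArg Prod.snd (h (0, x) (by simp [hx]))
  · rintro rfl
    refine ⟨(1, 1), fun a ha => ?_⟩
    rw [Matrix.mul_one, Matrix.mul_one] at ha
    exact ha
end

section
/- Let A^ev = ℍ_R ⊕ ℍ_L ⊕ M₄(ℂ) act on H_F = H₁ ⊕ H₂ with H₁ = (ℂ² ⊕ ℂ²) ⊗ ℂ⁴ and H₂ = ℂ⁴ ⊗ (ℂ² ⊕ ℂ²) (each of complex dimension 16), where (q_R, q_L, m) acts on H₁ as (q_R ⊕ q_L) ⊗ 1₄ and on H₂ as m ⊗ 1₄, and let J_F be the anti-unitary operator that exchanges H₁ and H₂ combined with complex conjugation. Write a self-adjoint operator D on H_F in block form D = [[S, T*], [T, S̄]] with respect to H₁ ⊕ H₂. Let B ⊆ A^ev be a unital *-subalgebra for which there exists such a self-adjoint D with off-diagonal block T ≠ 0 satisfying the first-order condition [[D, a], J_F b* J_F⁻¹]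 = 0 for all a, b ∈ B. Then dim_ℝ B ≤ 24, and if dim_ℝ B = 24 then B is the image under some *-automorphism of A^ev of the subalgebra A_F = {(q_λ, q, diag(λ, m)) : λ ∈ ℂ, q ∈ ℍ_L, m ∈ M₃(ℂ)}, where q_λ = diag(λ, λ̄) ∈ ℍ_R. Consequently A_F ≅ ℂ ⊕ ℍ ⊕ M₃(ℂ). -/
open Matrix

open scoped Quaternion

/-- A `2×2` complex matrix is a quaternion, i.e. of the form
`[[α, β], [-β̄, ᾱ]]`. -/
def IsQuat (q : Matrix (Fin 2) (Fin 2) ℂ) : Prop :=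
  q 1 1 = star (q 0 0) ∧ q 1 0 = -star (q 0 1)

/-- The ambient algebra `M_2(ℂ) ⊕ M_2(ℂ) ⊕ M_4(ℂ)` containing
`A^ev = ℍ_R ⊕ ℍ_L ⊕ M_4(ℂ)`; the `M_4(ℂ)`-factor is indexed by
`Fin 1 ⊕ Fin 3` to display the splitting `ℂ ⊕ M_3(ℂ)`. -/
abbrev AmbSM : Type :=
  Matrix (Fin 2) (Fin 2) ℂ × Matrix (Fin 2) (Fin 2) ℂ ×
    Matrix (Fin 1 ⊕ Fin 3) (Fin 1 ⊕ Fin 3) ℂ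

/-- The subset `A^ev = ℍ_R ⊕ ℍ_L ⊕ M_4(ℂ)` of the ambient algebra. -/
def AevSet : Set AmbSM := {a | IsQuat a.1 ∧ IsQuat a.2.1}

/-- The Standard Model subalgebra
`A_F = {(q_λ, q, diag(λ, m)) : λ ∈ ℂ, q ∈ ℍ_L, m ∈ M_3(ℂ)}`. -/
def AFSet : Set AmbSM :=
  {a | ∃ (l : ℂ) (q : Matrix (Fin 2) (Fin 2) ℂ) (m : Matrix (Fin 3) (Fin 3) ℂ),
    IsQuat q ∧
    a = (!![l, 0; 0, star l], q,
      fromBlocks (l • (1 : Matrix (Fin 1) (Fin 1) ℂ)) 0 0 m)}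

/-- The finite Hilbert space `H_F = H₁ ⊕ H₂` with
`H₁ = (ℂ² ⊕ ℂ²) ⊗ ℂ⁴` and `H₂ = ℂ⁴ ⊗ (ℂ² ⊕ ℂ²)`, realized as rectangular
matrices. -/
abbrev HFSM : Type :=
  Matrix (Fin 2 ⊕ Fin 2) (Fin 1 ⊕ Fin 3) ℂ ×
    Matrix (Fin 1 ⊕ Fin 3) (Fin 2 ⊕ Fin 2) ℂ

/-- The action of `(q_R, q_L, m)` on `H_F`: as `(q_R ⊕ q_L) ⊗ 1₄` on `H₁` and
as `m ⊗ 1₄` on `H₂`. -/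
noncomputable def repSM (a : AmbSM) (v : HFSM) : HFSM :=
  (fromBlocks a.1 0 0 a.2.1 * v.1, a.2.2 * v.2)

/-- The real structure `J_F`: it exchanges `H₁` and `H₂` combined with
complex conjugation. -/
def JSM (v : HFSM) : HFSM := (v.2ᴴ, v.1ᴴ)

/-- The Frobenius inner product on `H_F`. -/
noncomputable def innerSM (v w : HFSM) : ℂ :=
  (∑ i, ∑ j, star (v.1 i j) * w.1 i j) + (∑ i, ∑ j, star (v.2 i j) * w.2 i j)

lemma aux_intertw {n p p' n' : Type} [Fintype n] [Fintype p] [Fintype p'] [Fintype n']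
    [DecidableEq n] [DecidableEq p]
    (T : Matrix n p ℂ →ₗ[ℂ] Matrix p' n' ℂ) (hT : ∃ v, T v ≠ 0) :
    ∃ X : Matrix p' n ℂ, X ≠ 0 ∧ ∀ (Q : Matrix n n ℂ) (m : Matrix p' p' ℂ),
      (∀ v, T (Q * v) = m * T v) → X * Q = m * X := by
  let L : p → n' → Matrix p' n ℂ := fun j c => Matrix.of fun k l => T (Matrix.single l j 1) k c
  have key : ∀ (v : Matrix n p ℂ) k c, T v k c = ∑ j, ∑ l, v l j * L j c k l := by
    intro v k c
    conv_lhs => rw [Matrix.matrix_eq_sum_single v]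
    simp only [map_sum, Matrix.sum_apply, L, Matrix.of_apply]
    rw [Finset.sum_comm]
    refine Finset.sum_congr rfl fun j _ => Finset.sum_congr rfl fun l _ => ?_
    have : Matrix.single l j (v l j) = v l j • Matrix.single l j (1:ℂ) := by simp
    rw [this, map_smul]; rfl
  by_cases h0 : ∀ j c, L j c = 0
  · obtain ⟨v, hv⟩ := hT
    exact absurd (by ext k c; rw [key]; simp [h0]) hv
  · push Not at h0
    obtain ⟨j, c, hj⟩ := h0
    refine ⟨L j c, hj, fun Q m h => ?_⟩
    ext k l
    have h1 := congrFun (congrFun (h (Matrix.single l j 1)) k) c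
    rw [key, Matrix.mul_apply] at h1
    rw [Matrix.mul_apply, Matrix.mul_apply]
    simp only [L, Matrix.of_apply] at h1 ⊢
    rw [← h1, Finset.sum_eq_single j]
    · refine Finset.sum_congr rfl fun x _ => ?_
      rw [Matrix.mul_single_apply_same]; ring
    · intro b _ hb
      refine Finset.sum_eq_zero fun x _ => ?_
      rw [Matrix.mul_single_apply_of_ne _ _ _ _ _ hb]; ring
    · simp

lemma aux_X (B : Subalgebra ℝ AmbSM)
    (D : HFSM →ₗ[ℂ] HFSM)
    (hT : ∃ v₁ : Matrix (Fin 2 ⊕ Fin 2) (Fin 1 ⊕ Fin 3) ℂ, (D (v₁, 0)).2 ≠ 0)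
    (horder1 : ∀ a ∈ B, ∀ b ∈ B, ∀ v : HFSM,
      D (repSM a (JSM (repSM (star b) (JSM v)))) -
        repSM a (D (JSM (repSM (star b) (JSM v)))) =
      JSM (repSM (star b) (JSM (D (repSM a v) - repSM a (D v))))) :
    ∃ X : Matrix (Fin 1 ⊕ Fin 3) (Fin 2 ⊕ Fin 2) ℂ, X ≠ 0 ∧
      ∀ b ∈ B, X * fromBlocks b.1 0 0 b.2.1 = b.2.2 * X := by
  let T : Matrix (Fin 2 ⊕ Fin 2) (Fin 1 ⊕ Fin 3) ℂ →ₗ[ℂ]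
      Matrix (Fin 1 ⊕ Fin 3) (Fin 2 ⊕ Fin 2) ℂ :=
    (LinearMap.snd ℂ _ _) ∘ₗ D ∘ₗ (LinearMap.inl ℂ _ _)
  have hTv : ∀ v, T v = (D (v, 0)).2 := fun v => rfl
  have H : ∀ a ∈ B, ∀ b ∈ B, ∀ v,
      T (fromBlocks a.1 0 0 a.2.1 * v * b.2.2) - a.2.2 * T (v * b.2.2) =
      (T (fromBlocks a.1 0 0 a.2.1 * v) - a.2.2 * T v) * fromBlocks b.1 0 0 b.2.1 := by
    intro a ha b hb v
    have h := congrArg Prod.snd (horder1 a ha b hb (v, 0))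
    simpa [repSM, JSM, hTv, star_eq_conjTranspose, fromBlocks_conjTranspose,
      Matrix.conjTranspose_mul, Matrix.mul_assoc] using h
  by_cases hc : ∀ a ∈ B, ∀ v, T (fromBlocks a.1 0 0 a.2.1 * v) = a.2.2 * T v
  · obtain ⟨X, hX, h⟩ := aux_intertw T hT
    exact ⟨X, hX, fun b hb => h _ _ (hc b hb)⟩
  · push Not at hc
    obtain ⟨a, ha, v, hv⟩ := hc
    let Ta : Matrix (Fin 1 ⊕ Fin 3) (Fin 2 ⊕ Fin 2) ℂ →ₗ[ℂ]
        Matrix (Fin 2 ⊕ Fin 2) (Fin 1 ⊕ Fin 3) ℂ :=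
      { toFun := fun x => (T (fromBlocks a.1 0 0 a.2.1 * xᵀ) - a.2.2 * T xᵀ)ᵀ
        map_add' := by
          intro x y
          simp only [Matrix.transpose_add, Matrix.mul_add, map_add, Matrix.transpose_sub]
          abel
        map_smul' := by
          intro c x
          simp only [Matrix.transpose_smul, Matrix.mul_smul, map_smul, Matrix.transpose_sub,
            RingHom.id_apply, smul_sub] }
    have hTa : ∀ x, Ta x = (T (fromBlocks a.1 0 0 a.2.1 * xᵀ) - a.2.2 * T xᵀ)ᵀ := fun _ => rfl
    obtain ⟨X, hX, h⟩ := aux_intertw Ta ⟨vᵀ, by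
      rw [hTa, Matrix.transpose_transpose]
      intro h0
      exact hv (sub_eq_zero.1 (Matrix.transpose_eq_zero.1 h0))⟩
    refine ⟨Xᵀ, by simpa using hX, fun b hb => ?_⟩
    have := h (b.2.2)ᵀ (fromBlocks b.1 0 0 b.2.1)ᵀ (by
      intro x
      have h2 := H a ha b hb xᵀ
      rw [hTa, hTa, ← Matrix.transpose_mul, ← h2]
      simp [Matrix.transpose_mul, Matrix.mul_assoc])
    have h3 := congrArg Matrix.transpose this
    simp only [Matrix.transpose_mul, Matrix.transpose_transpose] at h3
    exact h3.symm

noncomputable def qmatSM (q : ℍ[ℝ]) : Matrix (Fin 2) (Fin 2) ℂ :=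
  !![⟨q.re, q.imI⟩, ⟨q.imJ, q.imK⟩; ⟨-q.imJ, q.imK⟩, ⟨q.re, -q.imI⟩]

noncomputable def fAFSM : (ℂ × ℍ[ℝ] × Matrix (Fin 3) (Fin 3) ℂ) →ₐ[ℝ] AmbSM where
  toFun x := (!![x.1, 0; 0, star x.1], qmatSM x.2.1,
      fromBlocks (x.1 • (1 : Matrix (Fin 1) (Fin 1) ℂ)) 0 0 x.2.2)
  map_one' := by
    refine Prod.ext ?_ (Prod.ext ?_ ?_)
    · simp [Matrix.one_fin_two]
    · ext i j
      fin_cases i <;> fin_cases j <;> simp [qmatSM, Complex.ext_iff]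
    · simp
  map_mul' x y := by
    refine Prod.ext ?_ (Prod.ext ?_ ?_)
    · simp [Matrix.mul_fin_two]
    · ext i j
      fin_cases i <;> fin_cases j <;>
        simp [qmatSM, Complex.ext_iff, Matrix.mul_apply, Fin.sum_univ_two] <;>
        constructor <;> ring
    · simp [fromBlocks_multiply, smul_smul, mul_comm]
  map_zero' := by
    refine Prod.ext ?_ (Prod.ext ?_ ?_)
    · ext i j
      fin_cases i <;> fin_cases j <;> simp
    · ext i j
      fin_cases i <;> fin_cases j <;> simp [qmatSM, Complex.ext_iff]
    · simp
  map_add' x y := by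
    refine Prod.ext ?_ (Prod.ext ?_ ?_)
    · ext i j
      fin_cases i <;> fin_cases j <;> simp
    · ext i j
      fin_cases i <;> fin_cases j <;> simp [qmatSM, Complex.ext_iff] <;> ring
    · simp [fromBlocks_add, add_smul]
  commutes' r := by
    refine Prod.ext ?_ (Prod.ext ?_ ?_)
    · ext i j
      fin_cases i <;> fin_cases j <;> simp [Matrix.algebraMap_matrix_apply]
    · ext i j
      fin_cases i <;> fin_cases j <;>
        simp [qmatSM, Complex.ext_iff, Matrix.algebraMap_matrix_apply]
    · ext i j
      rcases i with i | i <;> rcases j with j | j <;>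
        simp [Matrix.algebraMap_matrix_apply, Matrix.one_apply]

lemma fAFSM_inj : Function.Injective fAFSM := by
  rintro ⟨l, q, m⟩ ⟨l', q', m'⟩ h
  obtain ⟨h1, h2, h3⟩ := Prod.ext_iff.1 h |>.imp_right Prod.ext_iff.1
  simp only [fAFSM, AlgHom.coe_mk, RingHom.coe_mk, MonoidHom.coe_mk, OneHom.coe_mk] at h1 h2 h3
  have e1 := congrFun (congrFun h1 0) 0
  have e2 := congrFun (congrFun h2 0) 0
  have e3 := congrFun (congrFun h2 0) 1
  have e4 := (fromBlocks_inj.1 h3).2.2.2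
  simp [qmatSM, Complex.ext_iff] at e1 e2 e3
  refine Prod.ext ?_ (Prod.ext ?_ ?_)
  · simpa [Complex.ext_iff] using e1
  · ext <;> simp [e2, e3]
  · exact e4

lemma fAFSM_range : Set.range fAFSM = AFSet := by
  ext a
  constructor
  · rintro ⟨x, rfl⟩
    refine ⟨x.1, qmatSM x.2.1, x.2.2, ?_, rfl⟩
    simp [IsQuat, qmatSM, Complex.ext_iff]
  · rintro ⟨l, q, m, ⟨hq1, hq2⟩, rfl⟩
    refine ⟨(l, ⟨(q 0 0).re, (q 0 0).im, (q 0 1).re, (q 0 1).im⟩, m), ?_⟩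
    refine Prod.ext rfl (Prod.ext ?_ rfl)
    ext i j
    fin_cases i <;> fin_cases j <;> simp [fAFSM, qmatSM, Complex.ext_iff, hq1, hq2]

lemma isQuat_mul {p q : Matrix (Fin 2) (Fin 2) ℂ} (hp : IsQuat p) (hq : IsQuat q) :
    IsQuat (p * q) := by
  obtain ⟨h1, h2⟩ := hp
  obtain ⟨h3, h4⟩ := hq
  constructor <;> simp [Matrix.mul_apply, Fin.sum_univ_two, h1, h2, h3, h4] <;> ring

lemma isQuat_star {p : Matrix (Fin 2) (Fin 2) ℂ} (hp : IsQuat p) : IsQuat (star p) := by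
  obtain ⟨h1, h2⟩ := hp
  constructor <;> simp [star_eq_conjTranspose, h1, h2]

/-- a unitary with prescribed first column direction -/
lemma exists_U4 (w : Fin 1 ⊕ Fin 3 → ℂ) (hw : w ≠ 0) :
    ∃ U ∈ unitary (Matrix (Fin 1 ⊕ Fin 3) (Fin 1 ⊕ Fin 3) ℂ), ∃ c : ℂ, c ≠ 0 ∧
      ∀ i, U i (Sum.inl 0) = c * w i := by
  let w' : EuclideanSpace ℂ (Fin 1 ⊕ Fin 3) := WithLp.toLp 2 w
  have hw' : w' ≠ 0 := by
    intro h; apply hw; ext i; exact congrFun (congrArg WithLp.ofLp h) i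
  have hn : (‖w'‖ : ℂ) ≠ 0 := by simpa using hw'
  let c : ℂ := (‖w'‖ : ℂ)⁻¹
  let v : Fin 1 ⊕ Fin 3 → EuclideanSpace ℂ (Fin 1 ⊕ Fin 3) := fun _ => c • w'
  have ho : Orthonormal ℂ (({Sum.inl 0} : Set (Fin 1 ⊕ Fin 3)).domRestrict v) := by
    constructor
    · intro i
      simp only [Set.domRestrict, v, c]
      rw [norm_smul, norm_inv, Complex.norm_real, norm_norm, inv_mul_cancel₀]
      simpa using hw'
    · intro i j hij
      exact absurd (Subsingleton.elim i j) hij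
  obtain ⟨b, hb⟩ := ho.exists_orthonormalBasis_extension_of_card_eq (by simp)
  let U : Matrix (Fin 1 ⊕ Fin 3) (Fin 1 ⊕ Fin 3) ℂ := Matrix.of fun i j => b j i
  have hU : star U * U = 1 := by
    ext i j
    have := orthonormal_iff_ite.1 b.orthonormal i j
    rw [Matrix.one_apply, ← this]
    simp [U, Matrix.mul_apply, star_eq_conjTranspose, PiLp.inner_apply, mul_comm]
  refine ⟨U, ?_, c, inv_ne_zero hn, fun i => ?_⟩
  · exact Unitary.mem_iff.2 ⟨hU, mul_eq_one_comm.1 hU⟩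
  · have := hb (Sum.inl 0) rfl
    simp only [U, Matrix.of_apply, this]
    rfl

/-- the conclusion about `B` -/
def ConclSM (B : Subalgebra ℝ AmbSM) : Prop :=
  Module.finrank ℝ B ≤ 24 ∧
    (Module.finrank ℝ B = 24 →
      ∃ φ : AmbSM ≃ₐ[ℝ] AmbSM, (∀ x : AmbSM, φ (star x) = star (φ x)) ∧
        φ '' AevSet = AevSet ∧ φ '' AFSet = (B : Set AmbSM))

lemma concl_of_le (B : Subalgebra ℝ AmbSM) (φ : AmbSM ≃ₐ[ℝ] AmbSM)
    (h1 : ∀ x : AmbSM, φ (star x) = star (φ x)) (h2 : φ '' AevSet = AevSet)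
    (h3 : ∀ b ∈ B, φ.symm b ∈ AFSet) : ConclSM B := by
  let g : (ℂ × ℍ[ℝ] × Matrix (Fin 3) (Fin 3) ℂ) →ₐ[ℝ] AmbSM := φ.toAlgHom.comp fAFSM
  have hg : Function.Injective g := φ.injective.comp fAFSM_inj
  have hfr : Module.finrank ℝ (LinearMap.range g.toLinearMap) = 24 := by
    rw [LinearMap.finrank_range_of_inj hg, Module.finrank_prod, Module.finrank_prod,
      Quaternion.finrank_eq_four, Module.finrank_matrix, Complex.finrank_real_complex]
    simp
  have hle : Subalgebra.toSubmodule B ≤ LinearMap.range g.toLinearMap := by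
    intro b hb
    have := h3 b hb
    rw [← fAFSM_range] at this
    obtain ⟨x, hx⟩ := this
    refine ⟨x, ?_⟩
    change φ (fAFSM x) = b
    rw [hx]; simp
  refine ⟨hfr ▸ Submodule.finrank_mono hle, fun hB => ⟨φ, h1, h2, ?_⟩⟩
  have heq := Submodule.eq_of_le_of_finrank_eq hle (hB.trans hfr.symm)
  have : (B : Set AmbSM) = Set.range g := by
    ext x
    exact SetLike.ext_iff.1 heq x
  rw [this, ← fAFSM_range, ← Set.range_comp]
  rfl

lemma concl_of_eigen (B : Subalgebra ℝ AmbSM)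
    (hBstar : ∀ b ∈ B, star b ∈ B)
    (hBAev : ∀ b ∈ B, b ∈ AevSet)
    (u : Fin 2 → ℂ) (hu : u ≠ 0) (w : Fin 1 ⊕ Fin 3 → ℂ) (hw : w ≠ 0)
    (h : ∀ b ∈ B, ∃ l : ℂ, b.1 *ᵥ u = l • u ∧ b.2.2 *ᵥ w = l • w) : ConclSM B := by
  obtain ⟨U, hU, c, hc, hUw⟩ := exists_U4 w hw
  let n : ℝ := ‖u 0‖ ^ 2 + ‖u 1‖ ^ 2
  have hn : 0 < n := by
    by_contra hle
    apply hu
    have e0 : ‖u 0‖ ^ 2 = 0 := by nlinarith [sq_nonneg ‖u 0‖, sq_nonneg ‖u 1‖]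
    have e1 : ‖u 1‖ ^ 2 = 0 := by nlinarith [sq_nonneg ‖u 0‖, sq_nonneg ‖u 1‖]
    ext i; fin_cases i
    · simpa using e0
    · simpa using e1
  let s : ℂ := ((Real.sqrt n)⁻¹ : ℝ)
  have hs : star s = s := Complex.conj_ofReal _
  have hs0 : s ≠ 0 := by
    simp only [s, ne_eq, Complex.ofReal_eq_zero, inv_eq_zero]
    exact (Real.sqrt_pos.2 hn).ne'
  have hsn : s * s * (star (u 0) * u 0 + star (u 1) * u 1) = 1 := by
    have e : (star (u 0) * u 0 + star (u 1) * u 1) = (n : ℂ) := by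
      have a0 : star (u 0) * u 0 = ((‖u 0‖ ^ 2 : ℝ) : ℂ) := by
        have := Complex.conj_mul' (u 0); push_cast; exact this
      have a1 : star (u 1) * u 1 = ((‖u 1‖ ^ 2 : ℝ) : ℂ) := by
        have := Complex.conj_mul' (u 1); push_cast; exact this
      rw [a0, a1]; simp only [n]; push_cast; rfl
    rw [e]
    simp only [s]
    rw [← Complex.ofReal_mul, ← Complex.ofReal_mul, ← Complex.ofReal_one]
    congr 1
    have := Real.mul_self_sqrt hn.le
    have h2 := (Real.sqrt_pos.2 hn).ne'
    field_simp
    nlinarith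
  let V : Matrix (Fin 2) (Fin 2) ℂ := !![s * u 0, -(s * star (u 1)); s * u 1, s * star (u 0)]
  have hs' : (starRingEnd ℂ) s = s := hs
  have hVq : IsQuat V := by constructor <;> simp [V, hs']
  have hVV : star V * V = 1 := by
    simp only [Complex.star_def] at hsn
    ext i j
    fin_cases i <;> fin_cases j <;>
      simp [V, star_eq_conjTranspose, Matrix.mul_apply, Fin.sum_univ_two, hs']
    · linear_combination hsn
    · ring
    · ring
    · linear_combination hsn
  have hV : V ∈ unitary (Matrix (Fin 2) (Fin 2) ℂ) :=
    Unitary.mem_iff.2 ⟨hVV, mul_eq_one_comm.1 hVV⟩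
  have hUU := (Unitary.mem_iff.1 hU).1
  have hA : ((V, 1, U) : AmbSM) ∈ unitary AmbSM := by
    rw [Unitary.mem_iff]
    constructor
    · refine Prod.ext hVV (Prod.ext (by simp) hUU)
    · refine Prod.ext (Unitary.mem_iff.1 hV).2 (Prod.ext (by simp) (Unitary.mem_iff.1 hU).2)
  let φ : AmbSM ≃⋆ₐ[ℝ] AmbSM := Unitary.conjStarAlgAut ℝ AmbSM ⟨_, hA⟩
  have hφ : ∀ x, φ x = (V * x.1 * star V, 1 * x.2.1 * star 1, U * x.2.2 * star U) := fun x => rfl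
  have hφs : ∀ x, φ.symm x = (star V * x.1 * V, star 1 * x.2.1 * 1, star U * x.2.2 * U) :=
    fun x => rfl
  refine concl_of_le B φ.toAlgEquiv (fun x => map_star φ x) ?_ ?_
  · apply Set.Subset.antisymm
    · rintro _ ⟨x, ⟨hx1, hx2⟩, rfl⟩
      change φ x ∈ AevSet
      rw [hφ]
      exact ⟨isQuat_mul (isQuat_mul hVq hx1) (isQuat_star hVq), by simpa using hx2⟩
    · intro x hx
      refine ⟨φ.symm x, ?_, φ.apply_symm_apply x⟩
      rw [hφs]
      exact ⟨isQuat_mul (isQuat_mul (isQuat_star hVq) hx.1) hVq, by simpa using hx.2⟩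
  · intro b hb
    change φ.symm b ∈ AFSet
    rw [hφs]
    have hcol : ∀ b ∈ B, ∀ l : ℂ, b.2.2 *ᵥ w = l • w →
        (star U * b.2.2 * U) *ᵥ (Pi.single (Sum.inl 0) 1) = l • (Pi.single (Sum.inl 0) 1) := by
      intro b hb l hl
      have e : U *ᵥ (Pi.single (Sum.inl 0) 1) = c • w := by
        ext i; simp [hUw]
      have e2 : star U *ᵥ (c • w) = Pi.single (Sum.inl 0) 1 := by
        rw [← e, Matrix.mulVec_mulVec, hUU, Matrix.one_mulVec]
      rw [← Matrix.mulVec_mulVec, e, ← Matrix.mulVec_mulVec, Matrix.mulVec_smul, hl, smul_comm,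
        Matrix.mulVec_smul, e2]
    obtain ⟨l, hl1, hl2⟩ := h b hb
    obtain ⟨l', -, hl2'⟩ := h _ (hBstar b hb)
    have c1 := hcol b hb l hl2
    have c2 := hcol _ (hBstar b hb) l' hl2'
    set M := star U * b.2.2 * U with hM
    have hMs : star U * (star b).2.2 * U = star M := by
      simp [hM, Matrix.mul_assoc, star_mul]
    rw [hMs] at c2
    have d1 : ∀ i, M i (Sum.inl 0) = if i = Sum.inl 0 then l else 0 := by
      intro i
      have := congrFun c1 i
      simpa [Pi.single_apply] using this
    have d2 : ∀ i, i ≠ Sum.inl 0 → M (Sum.inl 0) i = 0 := by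
      intro i hi
      have := congrFun c2 i
      simpa [Pi.single_apply, hi, star_eq_conjTranspose] using this
    refine ⟨l, b.2.1, M.toBlocks₂₂, (hBAev b hb).2, ?_⟩
    refine Prod.ext ?_ (Prod.ext (by simp) ?_)
    · have : b.1 * V = V * !![l, 0; 0, star l] := by
        obtain ⟨q1, q2⟩ := (hBAev b hb).1
        have f0 := congrFun hl1 0
        have f1 := congrFun hl1 1
        simp [Matrix.mulVec, dotProduct, Fin.sum_univ_two, q1, q2] at f0 f1
        have g0 := congrArg (starRingEnd ℂ) f0
        have g1 := congrArg (starRingEnd ℂ) f1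
        simp at g0 g1
        ext i j
        fin_cases i <;> fin_cases j <;>
          simp [V, Matrix.mul_apply, Fin.sum_univ_two, q1, q2]
        · linear_combination s * f0
        · linear_combination -s * g1
        · linear_combination s * f1
        · linear_combination s * g0
      change star V * b.1 * V = _
      rw [Matrix.mul_assoc, this, ← Matrix.mul_assoc, hVV, Matrix.one_mul]
    · change M = _
      ext i j
      rcases i with i | i <;> rcases j with j | j
      · fin_cases i; fin_cases j; simp [d1]
      · fin_cases i; simp [d2]
      · fin_cases j; simp [d1]
      · rfl

lemma concl_of_ker (B : Subalgebra ℝ AmbSM)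
    (hBstar : ∀ b ∈ B, star b ∈ B)
    (hBAev : ∀ b ∈ B, b ∈ AevSet)
    (Y : Matrix (Fin 1 ⊕ Fin 3) (Fin 2) ℂ) (hY : Y ≠ 0)
    (h : ∀ b ∈ B, Y * b.1 = b.2.2 * Y)
    (k : Fin 2 → ℂ) (hk : k ≠ 0) (hYk : Y *ᵥ k = 0) : ConclSM B := by
  have hindep : ∀ z : Fin 2 → ℂ, Y *ᵥ z = 0 → z 0 * k 1 - z 1 * k 0 = 0 := by
    intro z hz
    by_contra hne
    apply hY
    ext i j
    have e1 := congrFun hz i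
    have e2 := congrFun hYk i
    simp [Matrix.mulVec, dotProduct, Fin.sum_univ_two] at e1 e2
    fin_cases j
    · apply (mul_eq_zero.1 (_ : Y i 0 * (z 0 * k 1 - z 1 * k 0) = 0)).resolve_right hne
      linear_combination k 1 * e1 - z 1 * e2
    · apply (mul_eq_zero.1 (_ : Y i 1 * (z 0 * k 1 - z 1 * k 0) = 0)).resolve_right hne
      linear_combination z 0 * e2 - k 0 * e1
  let n : ℂ := k 0 * (starRingEnd ℂ) (k 0) + k 1 * (starRingEnd ℂ) (k 1)
  have hn : n ≠ 0 := by
    intro h0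
    apply hk
    simp only [n, Complex.mul_conj, ← Complex.ofReal_add] at h0
    have h1 := Complex.ofReal_eq_zero.1 h0
    have p0 := Complex.normSq_nonneg (k 0)
    have p1 := Complex.normSq_nonneg (k 1)
    have r0 : k 0 = 0 := Complex.normSq_eq_zero.1 (by linarith)
    have r1 : k 1 = 0 := Complex.normSq_eq_zero.1 (by linarith)
    ext i; fin_cases i
    · exact r0
    · exact r1
  let u : Fin 2 → ℂ := ![-(starRingEnd ℂ) (k 1), (starRingEnd ℂ) (k 0)]
  have hYu : Y *ᵥ u ≠ 0 := by
    intro h0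
    have := hindep u h0
    simp [u] at this
    apply hn
    simp only [n]
    linear_combination -this
  refine concl_of_eigen B hBstar hBAev u ?_ (Y *ᵥ u) hYu ?_
  · intro h0; rw [h0] at hYu; simp at hYu
  · intro b hb
    have hz := hindep (b.1 *ᵥ k) (by
      rw [Matrix.mulVec_mulVec, h b hb, ← Matrix.mulVec_mulVec, hYk, Matrix.mulVec_zero])
    obtain ⟨l, hl0, hl1⟩ : ∃ l : ℂ, (b.1 *ᵥ k) 0 = l * k 0 ∧ (b.1 *ᵥ k) 1 = l * k 1 := by
      generalize b.1 *ᵥ k = z at hz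
      refine ⟨(z 0 * (starRingEnd ℂ) (k 0) + z 1 * (starRingEnd ℂ) (k 1)) / n, ?_, ?_⟩
      · field_simp
        simp only [n]
        linear_combination (starRingEnd ℂ) (k 1) * hz
      · field_simp
        simp only [n]
        linear_combination -(starRingEnd ℂ) (k 0) * hz
    have hu : b.1 *ᵥ u = (starRingEnd ℂ) l • u := by
      obtain ⟨q1, q2⟩ := (hBAev b hb).1
      have g0 := congrArg (starRingEnd ℂ) hl0
      have g1 := congrArg (starRingEnd ℂ) hl1
      simp [Matrix.mulVec, dotProduct, Fin.sum_univ_two, q1, q2] at g0 g1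
      ext i
      fin_cases i <;> simp [Matrix.mulVec, dotProduct, Fin.sum_univ_two, q1, q2, u]
      · linear_combination -g1
      · linear_combination g0
    refine ⟨_, hu, ?_⟩
    rw [Matrix.mulVec_mulVec, ← h b hb, ← Matrix.mulVec_mulVec, hu, Matrix.mulVec_smul]

lemma mul_surj_zero {p n r : Type} [Fintype p] [Fintype n] [Fintype r]
    [DecidableEq p] (A : Matrix r p ℂ) (P : Matrix p n ℂ)
    (hP : Function.Surjective P.mulVecLin) (h : A * P = 0) : A = 0 := by
  apply Matrix.ext_of_mulVec_single
  intro i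
  obtain ⟨x, hx⟩ := hP (Pi.single i 1)
  rw [← hx, Matrix.mulVecLin_apply, Matrix.mulVec_mulVec, h]
  simp

open scoped ComplexOrder in
lemma concl_of_inj (B : Subalgebra ℝ AmbSM)
    (hBstar : ∀ b ∈ B, star b ∈ B)
    (hBAev : ∀ b ∈ B, b ∈ AevSet)
    (Y : Matrix (Fin 1 ⊕ Fin 3) (Fin 2) ℂ)
    (h : ∀ b ∈ B, Y * b.1 = b.2.2 * Y)
    (hk : ∀ k, Y *ᵥ k = 0 → k = 0) : ConclSM B := by
  have hinj : Function.Injective Y.mulVecLin :=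
    (injective_iff_map_eq_zero _).2 fun k hk0 => hk k hk0
  have hrank : Yᴴ.rank = 2 := by
    rw [Matrix.rank_conjTranspose, Matrix.rank, LinearMap.finrank_range_of_inj hinj]; simp
  have hW : Module.finrank ℂ (LinearMap.ker Yᴴ.mulVecLin) = 2 := by
    have := LinearMap.finrank_range_add_finrank_ker Yᴴ.mulVecLin
    rw [Matrix.rank] at hrank
    simp [hrank] at this
    omega
  let bW := Module.finBasisOfFinrankEq ℂ _ hW
  let Z : Matrix (Fin 1 ⊕ Fin 3) (Fin 2) ℂ := Matrix.of fun i j => (bW j : Fin 1 ⊕ Fin 3 → ℂ) i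
  have hZ : ∀ x, Z *ᵥ x = ((∑ j, x j • bW j : LinearMap.ker Yᴴ.mulVecLin) : Fin 1 ⊕ Fin 3 → ℂ) := by
    intro x
    ext i
    simp [Z, Matrix.mulVec, dotProduct, mul_comm]
  have hZY : ∀ x, Yᴴ *ᵥ (Z *ᵥ x) = 0 := by
    intro x
    rw [hZ]
    exact (∑ j, x j • bW j : LinearMap.ker Yᴴ.mulVecLin).2
  let P : Matrix (Fin 1 ⊕ Fin 3) (Fin 2 ⊕ Fin 2) ℂ := fromCols Y Z
  have hPinj : Function.Injective P.mulVecLin := by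
    refine (injective_iff_map_eq_zero _).2 fun x hx => ?_
    have e : Y *ᵥ (x ∘ Sum.inl) + Z *ᵥ (x ∘ Sum.inr) = 0 := by
      rw [← Matrix.fromCols_mulVec]; exact hx
    have e1 : Y *ᵥ (x ∘ Sum.inl) = 0 := by
      have := congrArg (Yᴴ *ᵥ ·) e
      simp only [Matrix.mulVec_add, hZY, add_zero, Matrix.mulVec_zero] at this
      rw [Matrix.mulVec_mulVec] at this
      exact (Matrix.conjTranspose_mul_self_mulVec_eq_zero _ _).1 this
    have e2 := hk _ e1
    rw [e1, zero_add, hZ] at e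
    have e3 : (∑ j, (x ∘ Sum.inr) j • bW j) = 0 := Subtype.ext e
    have e4 := Fintype.linearIndependent_iff.1 bW.linearIndependent _ e3
    ext i
    rcases i with i | i
    · exact congrFun e2 i
    · exact e4 i
  have hPsurj : Function.Surjective P.mulVecLin :=
    (LinearMap.injective_iff_surjective_of_finrank_eq_finrank (by simp)).1 hPinj
  let g : B →ₗ[ℝ] (ℂ × ℂ) × (ℂ × ℂ) × Matrix (Fin 2) (Fin 2) ℂ :=
    { toFun := fun b => ((b.1.1 0 0, b.1.1 0 1), (b.1.2.1 0 0, b.1.2.1 0 1), Zᴴ * b.1.2.2 * Z)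
      map_add' := by
        intro x y
        simp [Matrix.mul_add, Matrix.add_mul]
      map_smul' := by
        intro c x
        simp }
  have hg : Function.Injective g := by
    refine (injective_iff_map_eq_zero _).2 fun b hb => ?_
    have hb' : ((b.1.1 0 0, b.1.1 0 1), (b.1.2.1 0 0, b.1.2.1 0 1), Zᴴ * b.1.2.2 * Z) =
      (0 : (ℂ × ℂ) × (ℂ × ℂ) × Matrix (Fin 2) (Fin 2) ℂ) := hb
    simp only [Prod.mk_eq_zero] at hb'
    obtain ⟨⟨a1, a2⟩, ⟨a3, a4⟩, a5⟩ := hb'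
    obtain ⟨⟨q1, q2⟩, ⟨q3, q4⟩⟩ := hBAev b.1 b.2
    have z1 : b.1.1 = 0 := by
      ext i j; fin_cases i <;> fin_cases j <;> simp [a1, a2, q1, q2]
    have z2 : b.1.2.1 = 0 := by
      ext i j; fin_cases i <;> fin_cases j <;> simp [a3, a4, q3, q4]
    have y1 : b.1.2.2 * Y = 0 := by rw [← h _ b.2, z1, Matrix.mul_zero]
    have y2 : Yᴴ * b.1.2.2 = 0 := by
      have := h _ (hBstar _ b.2)
      have h2 : (star b.1).1 = 0 := by
        change star (b.1.1) = 0
        rw [z1, star_zero]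
      rw [h2, Matrix.mul_zero] at this
      have h3 := congrArg Matrix.conjTranspose this
      have h4 : (star b.1).2.2 = (b.1.2.2)ᴴ := rfl
      rw [h4, Matrix.conjTranspose_mul, Matrix.conjTranspose_conjTranspose] at h3
      simpa using h3.symm
    have y3 : Pᴴ * (b.1.2.2 * P) = 0 := by
      simp only [P, Matrix.conjTranspose_fromCols_eq_fromRows_conjTranspose, Matrix.mul_fromCols,
        Matrix.fromRows_mul]
      rw [y1, ← Matrix.mul_assoc, ← Matrix.mul_assoc, y2, a5]
      ext i j
      rcases i with i | i <;> rcases j with j | j <;> simp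
    have y4 : (b.1.2.2 * P)ᴴ * P = 0 := by
      have := congrArg Matrix.conjTranspose y3
      simpa [Matrix.conjTranspose_mul] using this
    have y5 := mul_surj_zero _ P hPsurj y4
    have z3 : b.1.2.2 = 0 := mul_surj_zero _ P hPsurj (Matrix.conjTranspose_eq_zero.1 y5)
    exact Subtype.ext (Prod.ext z1 (Prod.ext z2 z3))
  have hle := LinearMap.finrank_le_finrank_of_injective hg
  have : Module.finrank ℝ ((ℂ × ℂ) × (ℂ × ℂ) × Matrix (Fin 2) (Fin 2) ℂ) = 16 := by
    simp only [Module.finrank_prod, Module.finrank_matrix, Complex.finrank_real_complex]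
    simp
  rw [this] at hle
  exact ⟨by omega, fun h => by omega⟩

lemma concl_of_Y (B : Subalgebra ℝ AmbSM)
    (hBstar : ∀ b ∈ B, star b ∈ B)
    (hBAev : ∀ b ∈ B, b ∈ AevSet)
    (Y : Matrix (Fin 1 ⊕ Fin 3) (Fin 2) ℂ) (hY : Y ≠ 0)
    (h : ∀ b ∈ B, Y * b.1 = b.2.2 * Y) : ConclSM B := by
  by_cases hk : ∀ k, Y *ᵥ k = 0 → k = 0
  · exact concl_of_inj B hBstar hBAev Y h hk
  · push Not at hk
    obtain ⟨k, hk1, hk2⟩ := hk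
    exact concl_of_ker B hBstar hBAev Y hY h k hk2 hk1

/-- the swap of the two quaternionic summands -/
def swapSM : AmbSM ≃ₐ[ℝ] AmbSM where
  toFun x := (x.2.1, x.1, x.2.2)
  invFun x := (x.2.1, x.1, x.2.2)
  left_inv _ := rfl
  right_inv _ := rfl
  map_mul' _ _ := rfl
  map_add' _ _ := rfl
  commutes' _ := rfl

lemma swap_Aev : swapSM '' AevSet = AevSet := by
  ext x
  constructor
  · rintro ⟨y, hy, rfl⟩
    exact ⟨hy.2, hy.1⟩
  · intro hx
    exact ⟨swapSM x, ⟨hx.2, hx.1⟩, rfl⟩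

lemma concl_swap (B : Subalgebra ℝ AmbSM) (h : ConclSM (B.map swapSM.toAlgHom)) : ConclSM B := by
  have hfr : Module.finrank ℝ (B.map swapSM.toAlgHom) = Module.finrank ℝ B :=
    (LinearEquiv.finrank_eq (swapSM.toLinearEquiv.submoduleMap (Subalgebra.toSubmodule B))).symm
  obtain ⟨h1, h2⟩ := h
  rw [hfr] at h1 h2
  refine ⟨h1, fun h24 => ?_⟩
  obtain ⟨φ, hs, ha, hf⟩ := h2 h24
  refine ⟨φ.trans swapSM, fun x => ?_, ?_, ?_⟩
  · change swapSM (φ (star x)) = star (swapSM (φ x))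
    rw [hs]; rfl
  · have : (φ.trans swapSM) '' AevSet = swapSM '' (φ '' AevSet) := by
      rw [Set.image_image]; rfl
    rw [this, ha, swap_Aev]
  · have : (φ.trans swapSM) '' AFSet = swapSM '' (φ '' AFSet) := by
      rw [Set.image_image]; rfl
    rw [this, hf]
    ext x
    constructor
    · rintro ⟨y, ⟨z, hz, rfl⟩, rfl⟩
      exact hz
    · intro hx
      exact ⟨swapSM x, ⟨x, hx, rfl⟩, rfl⟩

/-- Chamseddine–Connes–Marcolli (Prop. 2.11): if `B ⊆ A^ev` is a unital
*-subalgebra admitting a self-adjoint Dirac operator `D = [[S, T*], [T, S̄]]`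
(i.e. self-adjoint and commuting with `J_F`) with nonzero off-diagonal block
`T`, satisfying the first-order condition with respect to `B`, then
`dim_ℝ B ≤ 24`; if `dim_ℝ B = 24` then `B` is the image of
`A_F = {(q_λ, q, diag(λ, m))}` under a *-automorphism of `A^ev`; and
`A_F ≅ ℂ ⊕ ℍ ⊕ M_3(ℂ)` as a real algebra. -/
theorem stmt_5 (B : Subalgebra ℝ AmbSM)
    (hBstar : ∀ b ∈ B, star b ∈ B)
    (hBAev : ∀ b ∈ B, b ∈ AevSet)
    (D : HFSM →ₗ[ℂ] HFSM)
    (hDsa : ∀ v w : HFSM, innerSM (D v) w = innerSM v (D w))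
    (hDJ : ∀ v : HFSM, D (JSM v) = JSM (D v))
    (hT : ∃ v₁ : Matrix (Fin 2 ⊕ Fin 2) (Fin 1 ⊕ Fin 3) ℂ, (D (v₁, 0)).2 ≠ 0)
    (horder1 : ∀ a ∈ B, ∀ b ∈ B, ∀ v : HFSM,
      D (repSM a (JSM (repSM (star b) (JSM v)))) -
        repSM a (D (JSM (repSM (star b) (JSM v)))) =
      JSM (repSM (star b) (JSM (D (repSM a v) - repSM a (D v))))) :
    Module.finrank ℝ B ≤ 24 ∧
    (Module.finrank ℝ B = 24 →
      ∃ φ : AmbSM ≃ₐ[ℝ] AmbSM, (∀ x : AmbSM, φ (star x) = star (φ x)) ∧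
        φ '' AevSet = AevSet ∧ φ '' AFSet = (B : Set AmbSM)) ∧
    (∃ f : (ℂ × ℍ[ℝ] × Matrix (Fin 3) (Fin 3) ℂ) →ₐ[ℝ] AmbSM,
      Function.Injective f ∧ Set.range f = AFSet) := by
  refine (and_assoc.1 ⟨?_, fAFSM, fAFSM_inj, fAFSM_range⟩)
  change ConclSM B
  obtain ⟨X, hX, h⟩ := aux_X B D hT horder1
  have hX2 : fromCols X.toCols₁ X.toCols₂ = X := Matrix.fromCols_toCols X
  have hb : ∀ b ∈ B, X.toCols₁ * b.1 = b.2.2 * X.toCols₁ ∧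
      X.toCols₂ * b.2.1 = b.2.2 * X.toCols₂ := by
    intro b hb
    have := h b hb
    rw [← hX2, Matrix.fromCols_mul_fromBlocks, Matrix.mul_fromCols] at this
    simpa using (Matrix.fromCols_inj this)
  by_cases h1 : X.toCols₁ = 0
  · by_cases h2 : X.toCols₂ = 0
    · exact absurd (by rw [← hX2, h1, h2]; ext i j; rcases j with j | j <;> rfl) hX
    · apply concl_swap
      refine concl_of_Y _ ?_ ?_ X.toCols₂ h2 ?_
      · rintro _ ⟨b, hb, rfl⟩
        exact ⟨star b, hBstar b hb, rfl⟩
      · rintro _ ⟨b, hb, rfl⟩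
        exact ⟨(hBAev b hb).2, (hBAev b hb).1⟩
      · rintro _ ⟨b, hb', rfl⟩
        exact (hb b hb').2
  · exact concl_of_Y B hBstar hBAev _ h1 fun b hb' => (hb b hb').1
end

section
/- Let m_ν and m_R be real numbers. The 4×4 real symmetric matrix M = [[0, m_ν, m_R, 0], [m_ν, 0, 0, 0], [m_R, 0, 0, m_ν], [0, 0, m_ν, 0]] has characteristic polynomial (λ² - m_R λ - m_ν²)(λ² + m_R λ - m_ν²); equivalently, its eigenvalues are exactly the four numbers ±½ m_R ± ½ √(m_R² + 4 m_ν²). -/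
open Polynomial

/-- The one-generation seesaw mass matrix of the spectral Standard Model:
its characteristic polynomial factors as
`(λ² - m_R λ - m_ν²)(λ² + m_R λ - m_ν²)`, equivalently its eigenvalues are
exactly the four numbers `±½ m_R ± ½ √(m_R² + 4 m_ν²)`. -/
theorem stmt_6 (mν mR : ℝ) :
    Matrix.charpoly (!![0, mν, mR, 0;
                       mν, 0, 0, 0;
                       mR, 0, 0, mν;
                       0, 0, mν, 0] : Matrix (Fin 4) (Fin 4) ℝ) =
      (X ^ 2 - C mR * X - C (mν ^ 2)) * (X ^ 2 + C mR * X - C (mν ^ 2)) ∧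
    spectrum ℝ (!![0, mν, mR, 0;
                   mν, 0, 0, 0;
                   mR, 0, 0, mν;
                   0, 0, mν, 0] : Matrix (Fin 4) (Fin 4) ℝ) =
      {mR / 2 + Real.sqrt (mR ^ 2 + 4 * mν ^ 2) / 2,
       mR / 2 - Real.sqrt (mR ^ 2 + 4 * mν ^ 2) / 2,
       -(mR / 2) + Real.sqrt (mR ^ 2 + 4 * mν ^ 2) / 2,
       -(mR / 2) - Real.sqrt (mR ^ 2 + 4 * mν ^ 2) / 2} := by
  have h : Matrix.charpoly (!![0, mν, mR, 0;
                       mν, 0, 0, 0;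
                       mR, 0, 0, mν;
                       0, 0, mν, 0] : Matrix (Fin 4) (Fin 4) ℝ) =
      (X ^ 2 - C mR * X - C (mν ^ 2)) * (X ^ 2 + C mR * X - C (mν ^ 2)) := by
    unfold Matrix.charpoly
    have hc : Matrix.charmatrix (!![0, mν, mR, 0;
                       mν, 0, 0, 0;
                       mR, 0, 0, mν;
                       0, 0, mν, 0] : Matrix (Fin 4) (Fin 4) ℝ) =
        !![X, -C mν, -C mR, 0;
           -C mν, X, 0, 0;
           -C mR, 0, X, -C mν;
           0, 0, -C mν, X] := by
      ext1 i j
      fin_cases i <;> fin_cases j <;> simp [Matrix.charmatrix_apply]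
    rw [hc, Matrix.det_succ_row_zero]
    simp [Fin.sum_univ_succ, Matrix.det_fin_three, Fin.succAbove, Matrix.submatrix_apply]
    ring
  refine ⟨h, ?_⟩
  ext x
  rw [Matrix.mem_spectrum_iff_isRoot_charpoly, h]
  have hs : Real.sqrt (mR ^ 2 + 4 * mν ^ 2) ^ 2 = mR ^ 2 + 4 * mν ^ 2 :=
    Real.sq_sqrt (by positivity)
  generalize Real.sqrt (mR ^ 2 + 4 * mν ^ 2) = s at hs
  have e : (x ^ 2 - mR * x - mν ^ 2) * (x ^ 2 + mR * x - mν ^ 2) =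
      ((x - (mR / 2 + s / 2)) * (x - (mR / 2 - s / 2))) *
      ((x - (-(mR / 2) + s / 2)) * (x - (-(mR / 2) - s / 2))) := by
    have h1 : x ^ 2 - mR * x - mν ^ 2 = (x - (mR / 2 + s / 2)) * (x - (mR / 2 - s / 2)) := by
      linear_combination hs / 4
    have h2 : x ^ 2 + mR * x - mν ^ 2 =
        (x - (-(mR / 2) + s / 2)) * (x - (-(mR / 2) - s / 2)) := by
      linear_combination hs / 4
    rw [h1, h2]
  have e2 : eval x ((X ^ 2 - C mR * X - C (mν ^ 2)) * (X ^ 2 + C mR * X - C (mν ^ 2))) =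
      (x ^ 2 - mR * x - mν ^ 2) * (x ^ 2 + mR * x - mν ^ 2) := by
    simp only [eval_mul, eval_sub, eval_add, eval_pow, eval_X, eval_C]
  rw [IsRoot.def, e2, e]
  simp only [mul_eq_zero, sub_eq_zero, Set.mem_insert_iff, Set.mem_singleton_iff, or_assoc]
end

section
/- Let H be a finite-dimensional complex inner product space, D : H → H a self-adjoint linear operator, J : H → H a conjugate-linear bijection with ⟨Jx, Jy⟩ = ⟨y, x⟩ for all x, y, satisfying J² = -1 and JD = DJ, and γ : H → H a self-adjoint linear operator with γ² = 1, γD = -Dγ, and Jγ = -γJ. Then the pairing (ψ, ψ') ↦ ⟨Jψ, Dψ'⟩ is skew-symmetric on the +1-eigenspace of γ: for all ψ, ψ' ∈ H with γψ = ψ and γψ' = ψ', one has ⟨Jψ, Dψ'⟩ = -⟨Jψ', Dψ⟩. -/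
open scoped InnerProductSpace

/-- In KO-dimension 2 (mod 8), i.e. with `J² = -1`, `JD = DJ`, `Jγ = -γJ`,
the pairing `(ψ, ψ') ↦ ⟨Jψ, Dψ'⟩` is skew-symmetric on the `+1`-eigenspace
of the grading `γ`. -/
theorem stmt_8 {H : Type} [NormedAddCommGroup H] [InnerProductSpace ℂ H]
    [FiniteDimensional ℂ H]
    (D : H →ₗ[ℂ] H) (hD : ∀ x y : H, ⟪D x, y⟫_ℂ = ⟪x, D y⟫_ℂ)
    (J : H → H)
    (hJadd : ∀ x y, J (x + y) = J x + J y)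
    (hJsmul : ∀ (c : ℂ) (x : H), J (c • x) = star c • J x)
    (hJbij : Function.Bijective J)
    (hJinner : ∀ x y : H, ⟪J x, J y⟫_ℂ = ⟪y, x⟫_ℂ)
    (hJ2 : ∀ x, J (J x) = -x)
    (hJD : ∀ x, J (D x) = D (J x))
    (γ : H →ₗ[ℂ] H)
    (hγsa : ∀ x y : H, ⟪γ x, y⟫_ℂ = ⟪x, γ y⟫_ℂ)
    (hγ2 : ∀ x, γ (γ x) = x)
    (hγD : ∀ x, γ (D x) = - D (γ x))
    (hJγ : ∀ x, J (γ x) = - γ (J x)) :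
    ∀ ψ ψ' : H, γ ψ = ψ → γ ψ' = ψ' → ⟪J ψ, D ψ'⟫_ℂ = - ⟪J ψ', D ψ⟫_ℂ := by
  intro ψ ψ' _ _
  rw [← hJinner (D ψ') (J ψ), hJ2, hJD, inner_neg_right, hD]
end

section
/- Let H be a finite-dimensional complex Hilbert space, A a unital *-subalgebra of the linear operators on H, and J : H → H a conjugate-linear bijection with ⟨Jx, Jy⟩ = ⟨y, x⟩ for all x, y and J² = ε·1 with ε ∈ {+1, -1}. Let D be a self-adjoint operator with JD = DJ, and assume the order-zero condition [a, J b* J⁻¹] = 0 and the order-one condition [[D, a], J b* J⁻¹] = 0 for all a, b ∈ A. Let u ∈ A be unitary, set Ũ = u · (J u J⁻¹), and let A be any operator of the form A = Σᵢ aᵢ[D, bᵢ] with aᵢ, bᵢ ∈ A. Then Ũ is unitary and Ũ (D + A + J A J⁻¹) Ũ* = D + A_u + J A_u J⁻¹, where A_u = u A u* + u [D, u*]. -/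
open scoped InnerProductSpace

theorem aux_ring {R : Type*} [Ring R] (u v w z D o k : R) (huv : u * v = 1) (hwz : w * z = 1)
    (wu : u * w = w * u) (zv : v * z = z * v)
    (zu : u * z = z * u) (wo : o * w = w * o) (ku : k * u = u * k)
    (hD : (D * v - v * D) * w = w * (D * v - v * D)) :
    u * w * (D + o + k) * (z * v) =
      D + (u * o * v + u * D * v - u * v * D) + w * (k * z) + w * (D * z) - D := by
  have e1 : u * w * o * (z * v) = u * o * v := by
    calc u * w * o * (z * v) = u * (w * o) * (z * v) := by noncomm_ring
      _ = u * o * (w * z) * v := by rw [← wo]; noncomm_ring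
      _ = _ := by rw [hwz]; noncomm_ring
  have e2 : u * w * k * (z * v) = w * (k * z) := by
    calc u * w * k * (z * v) = w * (u * k) * (z * v) := by rw [wu]; noncomm_ring
      _ = w * k * (u * z) * v := by rw [← ku]; noncomm_ring
      _ = w * k * z * (u * v) := by rw [zu]; noncomm_ring
      _ = _ := by rw [huv]; noncomm_ring
  have e3 : u * w * D * (z * v) = u * D * v - u * v * D + w * (D * z) := by
    calc u * w * D * (z * v) = u * (w * (D * v - v * D)) * z + (u * w) * v * D * z := by
          rw [← zv]; noncomm_ring
      _ = u * (D * v - v * D) * (w * z) + w * (u * v) * D * z := by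
          rw [← hD, wu]; noncomm_ring
      _ = _ := by rw [hwz, huv]; simp only [mul_sub, ← mul_assoc, huv]; noncomm_ring
  have e : u * w * (D + o + k) * (z * v) =
    u * w * D * (z * v) + u * w * o * (z * v) + u * w * k * (z * v) := by noncomm_ring
  rw [e, e1, e2, e3]; noncomm_ring

/-- Gauge covariance of inner fluctuations of a real spectral triple: for a
unitary `u ∈ A`, the operator `Ũ = u (J u J⁻¹)` is unitary and conjugation
by `Ũ` transforms the fluctuated Dirac operator `D + A + J A J⁻¹`
(with `A = Σᵢ aᵢ[D, bᵢ]`) into `D + A_u + J A_u J⁻¹` where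
`A_u = u A u* + u [D, u*]`.  Here `J² = ε` with `ε = ±1`, so `J⁻¹ = ε J`. -/
theorem stmt_9 {H : Type} [NormedAddCommGroup H] [InnerProductSpace ℂ H]
    [FiniteDimensional ℂ H]
    (A : StarSubalgebra ℂ (H →ₗ[ℂ] H))
    (J : H → H)
    (hJadd : ∀ x y, J (x + y) = J x + J y)
    (hJsmul : ∀ (c : ℂ) (x : H), J (c • x) = star c • J x)
    (hJbij : Function.Bijective J)
    (hJinner : ∀ x y : H, ⟪J x, J y⟫_ℂ = ⟪y, x⟫_ℂ)
    (ε : ℂ) (hε : ε = 1 ∨ ε = -1)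
    (hJ2 : ∀ x, J (J x) = ε • x)
    (D : H →ₗ[ℂ] H)
    (hDsa : LinearMap.adjoint D = D)
    (hDJ : ∀ x, J (D x) = D (J x))
    (horder0 : ∀ a ∈ A, ∀ b ∈ A, ∀ x : H,
      a (J ((star b) (ε • J x))) = J ((star b) (ε • J (a x))))
    (horder1 : ∀ a ∈ A, ∀ b ∈ A, ∀ x : H,
      D (a (J ((star b) (ε • J x)))) - a (D (J ((star b) (ε • J x)))) =
        J ((star b) (ε • J (D (a x) - a (D x)))))
    (u : H →ₗ[ℂ] H) (hu : u ∈ A)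
    (huL : star u * u = 1) (huR : u * star u = 1)
    {ι : Type} (s : Finset ι) (a b : ι → (H →ₗ[ℂ] H))
    (ha : ∀ i ∈ s, a i ∈ A) (hb : ∀ i ∈ s, b i ∈ A)
    (ω : H →ₗ[ℂ] H) (hω : ω = ∑ i ∈ s, a i * (D * b i - b i * D)) :
    let U : H → H := fun x => u (J (u (ε • J x)))
    let Au : H → H := fun y => u (ω ((star u) y)) + u (D ((star u) y)) - u ((star u) (D y))
    (Function.Bijective U ∧ ∀ x y : H, ⟪U x, U y⟫_ℂ = ⟪x, y⟫_ℂ) ∧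
    ∀ V : H → H, (∀ x y : H, ⟪U x, y⟫_ℂ = ⟪x, V y⟫_ℂ) →
      ∀ x : H, U (D (V x) + ω (V x) + J (ω (ε • J (V x)))) =
        D x + Au x + J (Au (ε • J x)) := by
  intro U Au
  have hεs : star ε = ε := by rcases hε with h | h <;> simp [h]
  have hεε : ε * ε = 1 := by rcases hε with h | h <;> simp [h]
  have hJε : ∀ x, J (ε • x) = ε • J x := fun x => by rw [hJsmul, hεs]
  have hJJ : ∀ x, J (ε • J x) = x := fun x => by
    rw [hJε, hJ2, smul_smul, hεε, one_smul]
  have hJJ' : ∀ x, ε • J (J x) = x := fun x => by rw [hJ2, smul_smul, hεε, one_smul]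
  let c : (H →ₗ[ℂ] H) → (H →ₗ[ℂ] H) := fun T =>
    { toFun := fun x => J (T (ε • J x))
      map_add' := fun x y => by simp only [hJadd, smul_add, map_add]
      map_smul' := fun r x => by
        rw [hJsmul, smul_comm, map_smul, hJsmul, star_star]; rfl }
  have cap : ∀ T x, c T x = J (T (ε • J x)) := fun T x => rfl
  have cmul : ∀ S T, c (S * T) = c S * c T := fun S T => by
    ext x; simp only [cap, Module.End.mul_apply, hJJ']
  have cone : c 1 = 1 := by ext x; simp only [cap, Module.End.one_apply, hJJ]
  have ccc : ∀ T, c (c T) = T := fun T => by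
    ext x; simp only [cap, hJε, hJ2, smul_smul, hεε, one_smul, map_smul]
  have cD : c D = D := by
    ext x; rw [cap, hDJ, hJJ]
  have cadd : ∀ S T, c (S + T) = c S + c T := fun S T => by
    ext x; simp only [cap, LinearMap.add_apply, hJadd]
  have h0 : ∀ a ∈ A, ∀ b ∈ A, a * c b = c b * a := fun a ha b hb => by
    ext x
    have := horder0 a ha (star b) (star_mem hb) x
    rw [star_star] at this
    simpa only [Module.End.mul_apply, cap] using this
  have h1 : ∀ a ∈ A, ∀ b ∈ A, (D * a - a * D) * c b = c b * (D * a - a * D) :=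
    fun a ha b hb => by
    ext x
    have := horder1 a ha (star b) (star_mem hb) x
    rw [star_star] at this
    simpa only [Module.End.mul_apply, cap, LinearMap.sub_apply] using this
  have hωc : ∀ d ∈ A, ω * c d = c d * ω := fun d hd => by
    rw [hω, Finset.sum_mul, Finset.mul_sum]
    refine Finset.sum_congr rfl fun i hi => ?_
    rw [mul_assoc, h1 _ (hb i hi) d hd, ← mul_assoc, h0 _ (ha i hi) d hd, mul_assoc]
  have hvA : star u ∈ A := star_mem hu
  have hk : c ω * u = u * c ω := by
    have := congrArg c (hωc u hu)
    rwa [cmul, cmul, ccc] at this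
  have hwz : c u * c (star u) = 1 := by rw [← cmul, huR, cone]
  have hzw : c (star u) * c u = 1 := by rw [← cmul, huL, cone]
  have hU : ∀ x, U x = (u * c u) x := fun x => rfl
  have hUV : (u * c u) * (c (star u) * star u) = 1 := by
    rw [mul_assoc, ← mul_assoc (c u), hwz, one_mul, huR]
  have hVU : (c (star u) * star u) * (u * c u) = 1 := by
    rw [mul_assoc, ← mul_assoc (star u), huL, one_mul, hzw]
  have huin : ∀ x y : H, ⟪u x, u y⟫_ℂ = ⟪x, y⟫_ℂ := fun x y => by
    rw [← LinearMap.adjoint_inner_right]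
    have := congrArg (fun T : H →ₗ[ℂ] H => T y) huL
    simp only [Module.End.mul_apply, Module.End.one_apply, LinearMap.star_eq_adjoint] at this
    rw [this]
  have hUin : ∀ x y : H, ⟪U x, U y⟫_ℂ = ⟪x, y⟫_ℂ := fun x y => by
    change ⟪u (J (u (ε • J x))), u (J (u (ε • J y)))⟫_ℂ = _
    rw [huin, hJinner, huin, ← hJinner, hJJ, hJJ]
  have hUW : ∀ x, U ((c (star u) * star u) x) = x := fun x => by
    rw [hU, ← Module.End.mul_apply, hUV, Module.End.one_apply]
  refine ⟨⟨⟨?_, fun y => ⟨_, hUW y⟩⟩, hUin⟩, ?_⟩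
  · intro x y hxy
    have h := congrArg (c (star u) * star u) hxy
    rw [hU, hU, ← Module.End.mul_apply, ← Module.End.mul_apply, hVU] at h
    exact h
  intro V hV x
  have hVx : V x = (c (star u) * star u) x := by
    refine ext_inner_left ℂ fun y => ?_
    rw [← hV, ← hUin y, hUW]
  have key := aux_ring u (star u) (c u) (c (star u)) D ω (c ω) huR hwz (h0 u hu u hu)
    (h0 _ hvA _ hvA) (h0 u hu _ hvA) (hωc u hu) hk (h1 _ hvA u hu)
  have hAu : ∀ y, Au y = (u * ω * star u + u * D * star u - u * star u * D) y := fun y => rfl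
  have hcA : c (u * ω * star u + u * D * star u - u * star u * D) =
      c u * (c ω * c (star u)) + c u * (D * c (star u)) - D := by
    rw [eq_sub_iff_add_eq]
    conv_lhs => rw [← cD, ← cadd, cD]
    rw [huR, one_mul, sub_add_cancel, cadd, cmul, cmul, cmul, cmul, cD, mul_assoc, mul_assoc]
  have hkx := congrArg (fun T : H →ₗ[ℂ] H => T x) key
  have hl : U (D (V x) + ω (V x) + J (ω (ε • J (V x)))) =
      (u * c u * (D + ω + c ω) * (c (star u) * star u)) x := by
    rw [hVx]; rfl
  have hr : J (Au (ε • J x)) = (c (u * ω * star u + u * D * star u - u * star u * D)) x := rfl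
  rw [hl, key, hr, hcA, hAu]
  simp only [LinearMap.add_apply, LinearMap.sub_apply]
  abel
end

section
/- For every complex 2×2 matrix φ and every complex 2×4 matrix Δ, there exist unitary matrices u_R, u_L ∈ SU(2) and u ∈ SU(4) such that u_R φ u_L* = [[h, 0], [0, χ]] with h a real number and χ a complex number, and u_R Δ uᵗ = [[a, 0, 0, 0], [b, c, 0, 0]] with a, b, c real numbers (here uᵗ denotes the transpose of u). -/
open Matrix

lemma ex_phase (z : ℂ) : ∃ w : ℂ, w * star w = 1 ∧ (z * w).im = 0 := by
  by_cases hz : z = 0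
  · exact ⟨1, by simp, by simp [hz]⟩
  · refine ⟨star z / (‖z‖ : ℂ), ?_, ?_⟩
    · have h : (‖z‖ : ℂ) ≠ 0 := by simpa using hz
      have := Complex.mul_conj' z
      simp only [star_div₀, Complex.star_def, Complex.conj_conj, Complex.conj_ofReal]
      field_simp
      rw [mul_comm, this]
    · rw [← mul_div_assoc, Complex.star_def, Complex.mul_conj', ← Complex.ofReal_pow, ← Complex.ofReal_div, Complex.ofReal_im]

lemma ex_phase2 (x y : ℂ) (h : (x * star y).im = 0) :
    ∃ w : ℂ, w * star w = 1 ∧ (x * w).im = 0 ∧ (y * w).im = 0 := by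
  by_cases hx : x = 0
  · obtain ⟨w, h1, h2⟩ := ex_phase y
    exact ⟨w, h1, by simp [hx], h2⟩
  · obtain ⟨w, h1, h2⟩ := ex_phase x
    refine ⟨w, h1, h2, ?_⟩
    have hw : w ≠ 0 := by rintro rfl; simp at h1
    have e : (x * w) * star (y * w) = x * star y := by
      rw [star_mul]; linear_combination x * star y * h1
    have h3 : ((x * w) * star (y * w)).im = 0 := by rw [e, h]
    rw [Complex.mul_im, h2] at h3
    have h4 : (x * w).re ≠ 0 := fun h5 => (mul_ne_zero hx hw) (Complex.ext h5 h2)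
    simp only [Complex.star_def, Complex.conj_im, zero_mul, add_zero] at h3
    rcases mul_eq_zero.mp h3 with h | h
    · exact absurd h h4
    · linarith

lemma ex_phase_sq (δ z : ℂ) (hδ : δ * star δ = 1) : ∃ p q : ℂ, p * star p = 1 ∧ q * star q = 1 ∧
    p * q * δ = 1 ∧ (p * z * star q).im = 0 := by
  obtain ⟨w, h1, h2⟩ := ex_phase (δ * z)
  obtain ⟨p, hp⟩ := IsAlgClosed.exists_pow_nat_eq w (n := 2) (by norm_num)
  have hp1 : p * star p = 1 := by
    rw [← hp] at h1
    rw [Complex.star_def, Complex.mul_conj'] at h1 ⊢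
    norm_cast at h1 ⊢
    rw [norm_pow] at h1
    have : (‖p‖^2)^2 = 1 := h1
    nlinarith [sq_nonneg ‖p‖]
  refine ⟨p, star p * star δ, hp1, ?_, ?_, ?_⟩
  · simp only [star_mul, star_star]
    linear_combination p * star p * hδ + hp1
  · linear_combination p * star p * hδ + hp1
  · rw [← h2, ← hp]; congr 1; simp only [star_mul, star_star]; ring

lemma mem_U_diag {n : ℕ} (d : Fin n → ℂ) (h : ∀ i, d i * star (d i) = 1) :
    diagonal d ∈ unitaryGroup (Fin n) ℂ := by
  rw [mem_unitaryGroup_iff, star_eq_conjTranspose, diagonal_conjTranspose, diagonal_mul_diagonal]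
  rw [← diagonal_one]; congr 1; funext i; exact h i

lemma det_unit {n : ℕ} {V : Matrix (Fin n) (Fin n) ℂ} (h : V ∈ unitaryGroup (Fin n) ℂ) :
    V.det * star V.det = 1 := by
  rw [mem_unitaryGroup_iff] at h
  rw [← det_conjTranspose, ← det_mul, ← star_eq_conjTranspose, h, det_one]

lemma tri (M : Matrix (Fin 2) (Fin 4) ℂ) : ∃ V ∈ unitaryGroup (Fin 4) ℂ,
    (∀ j, 0 < j → (M * V) 0 j = 0) ∧ (∀ j, 1 < j → (M * V) 1 j = 0) := by
  let f : Fin 4 → EuclideanSpace ℂ (Fin 4) := ![WithLp.toLp 2 (M 0), WithLp.toLp 2 (M 1), 0, 0]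
  let b := InnerProductSpace.gramSchmidtOrthonormalBasis (𝕜 := ℂ) (by simp) f
  have hb : ∀ i j, i < j → inner ℂ (b j) (f i) = 0 := fun i j h =>
    InnerProductSpace.gramSchmidtOrthonormalBasis_inv_triangular _ _ h
  refine ⟨Matrix.of fun k j => star (b j k), ?_, ?_, ?_⟩
  · rw [mem_unitaryGroup_iff']
    ext j k
    have := orthonormal_iff_ite.mp b.orthonormal k j
    rw [PiLp.inner_apply] at this
    simp only [RCLike.inner_apply] at this
    simp only [mul_apply, star_apply, of_apply, star_star, one_apply]
    rw [Complex.star_def] at *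
    simp only [eq_comm (a := j)]
    exact this
  · intro j hj
    have := hb 0 j hj
    rw [PiLp.inner_apply] at this
    simpa [mul_apply, f] using this
  · intro j hj
    have := hb 1 j hj
    rw [PiLp.inner_apply] at this
    simpa [mul_apply, f] using this

lemma partΔ (M : Matrix (Fin 2) (Fin 4) ℂ) (hM : ((M * Mᴴ) 0 1).im = 0) :
    ∃ u ∈ specialUnitaryGroup (Fin 4) ℂ, 
      ∃ a b c : ℝ, M * uᵀ = !![(a : ℂ), 0, 0, 0; (b : ℂ), (c : ℂ), 0, 0] := by
  obtain ⟨V, hV, h0, h1⟩ := tri M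
  have hL : (M * V) * (M * V)ᴴ = M * Mᴴ := by
    rw [conjTranspose_mul, ← Matrix.mul_assoc, Matrix.mul_assoc M, ← star_eq_conjTranspose V,
      mem_unitaryGroup_iff.mp hV, Matrix.mul_one]
  rw [← hL] at hM
  simp only [mul_apply (M := M * V), Fin.sum_univ_four, conjTranspose_apply, h0 1 (by decide), h0 2 (by decide), h0 3 (by decide)] at hM
  simp only [zero_mul, add_zero] at hM
  obtain ⟨d0, e0, r0, r0'⟩ := ex_phase2 _ _ hM
  obtain ⟨d1, e1, r1⟩ := ex_phase ((M * V) 1 1)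
  have hdet := det_unit hV
  let d : Fin 4 → ℂ := ![d0, d1, 1, star (V.det * d0 * d1)]
  have hd : diagonal d ∈ unitaryGroup (Fin 4) ℂ := by
    apply mem_U_diag
    intro i
    fin_cases i
    · exact e0
    · exact e1
    · simp [d]
    · simp only [d, star_mul, star_star, cons_val]
      simp
      simp only [Complex.star_def] at *
      linear_combination d0 * (starRingEnd ℂ) d0 * d1 * (starRingEnd ℂ) d1 * hdet + d1 * (starRingEnd ℂ) d1 * e0 + e1
  have hVd := mul_mem hV hd
  refine ⟨(V * diagonal d)ᵀ, ?_, ?_⟩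
  · rw [mem_specialUnitaryGroup_iff]
    constructor
    · rw [mem_unitaryGroup_iff'] at hVd
      rw [mem_unitaryGroup_iff]
      have := congrArg transpose hVd
      rw [transpose_mul, transpose_one] at this
      exact this
    · rw [det_transpose, det_mul, det_diagonal, Fin.prod_univ_four]
      simp only [d, star_mul, cons_val]
      simp
      simp only [Complex.star_def] at *
      linear_combination d0 * (starRingEnd ℂ) d0 * d1 * (starRingEnd ℂ) d1 * hdet + d1 * (starRingEnd ℂ) d1 * e0 + e1
  · refine ⟨((M * V) 0 0 * d0).re, ((M * V) 1 0 * d0).re, ((M * V) 1 1 * d1).re, ?_⟩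
    have re : ∀ z : ℂ, z.im = 0 → z = (z.re : ℂ) := fun z h => Complex.ext rfl (by simp [h])
    rw [transpose_transpose, ← Matrix.mul_assoc, ← re _ r0, ← re _ r0', ← re _ r1]
    ext i j
    rw [mul_diagonal]
    fin_cases i <;> fin_cases j <;> simp [d, h0, h1]

lemma exN (p q : ℂ) (h : ¬ (p = 0 ∧ q = 0)) : ∃ N : ℝ, (N : ℂ) ≠ 0 ∧ p * star p + q * star q = N * N := by
  refine ⟨Real.sqrt (‖p‖^2 + ‖q‖^2), ?_, ?_⟩
  · rw [Complex.ofReal_ne_zero]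
    apply ne_of_gt
    apply Real.sqrt_pos.mpr
    by_cases hp : p = 0
    · have : q ≠ 0 := fun hq => h ⟨hp, hq⟩
      positivity
    · positivity
  · rw [← Complex.ofReal_mul, Real.mul_self_sqrt (by positivity)]
    simp only [Complex.star_def, Complex.mul_conj']
    push_cast; rfl

lemma partφ (M : Matrix (Fin 2) (Fin 2) ℂ) (hM : (M * Mᴴ) 1 0 = 0) :
    ∃ u ∈ specialUnitaryGroup (Fin 2) ℂ, 
      ∃ (h : ℝ) (χ : ℂ), M * uᴴ = !![(h : ℂ), 0; 0, χ] := by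
  have key : ∀ x y : ℂ, x * star x + y * star y = 1 → !![x, y; -star y, star x] ∈ specialUnitaryGroup (Fin 2) ℂ := by
    intro x y h
    rw [mem_specialUnitaryGroup_iff, mem_unitaryGroup_iff]
    constructor
    · ext i j
      fin_cases i <;> fin_cases j <;> simp [mul_apply, star_apply] <;> simp only [Complex.star_def] at h <;> first | linear_combination h | ring
    · rw [det_fin_two_of]; linear_combination h
  obtain ⟨p, q, r, s, rfl⟩ : ∃ p q r s, M = !![p, q; r, s] := ⟨_, _, _, _, eta_fin_two M⟩
  have ho : r * star p + s * star q = 0 := by simpa [mul_apply] using hM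
  by_cases h : p = 0 ∧ q = 0
  · obtain ⟨rfl, rfl⟩ := h
    by_cases h' : r = 0 ∧ s = 0
    · obtain ⟨rfl, rfl⟩ := h'
      refine ⟨1, one_mem _, 0, 0, ?_⟩
      simp
    · obtain ⟨N, hN, e⟩ := exN r s h'
      refine ⟨_, key (star s / N) (-star r / N) ?_, 0, N, ?_⟩
      · simp only [star_div₀, star_neg, star_star, Complex.star_def, Complex.conj_ofReal, Complex.conj_conj] at *
        field_simp
        linear_combination e
      · ext i j
        fin_cases i <;> fin_cases j <;> simp [mul_apply] <;> simp only [Complex.star_def] at e <;> field_simp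
        · ring
        · linear_combination e
  · obtain ⟨N, hN, e⟩ := exN p q h
    refine ⟨_, key (p / N) (q / N) ?_, N, (s * p - r * q) / N, ?_⟩
    · simp only [star_div₀, Complex.star_def, Complex.conj_ofReal] at *
      field_simp
      linear_combination e
    · ext i j
      fin_cases i <;> fin_cases j <;> simp [mul_apply] <;> simp only [Complex.star_def] at e ho <;> field_simp
      · linear_combination e
      · ring
      · linear_combination ho
      · ring

lemma diagLem (A : Matrix (Fin 2) (Fin 2) ℂ) (hA : A.IsHermitian) :
    ∃ W ∈ unitaryGroup (Fin 2) ℂ, (W * A * Wᴴ) 1 0 = 0 := by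
  have h := hA.conjStarAlgAut_star_eigenvectorUnitary
  rw [Unitary.conjStarAlgAut_apply] at h
  generalize star hA.eigenvectorUnitary = U at h
  refine ⟨U.1, U.2, ?_⟩
  have h2 : U.1 * A * U.1ᴴ = diagonal (RCLike.ofReal ∘ hA.eigenvalues) := h
  rw [h2]
  exact diagonal_apply_ne _ (by decide)

theorem stmt_10 (φ : Matrix (Fin 2) (Fin 2) ℂ) (Δ : Matrix (Fin 2) (Fin 4) ℂ) :
    ∃ uR ∈ Matrix.specialUnitaryGroup (Fin 2) ℂ,
    ∃ uL ∈ Matrix.specialUnitaryGroup (Fin 2) ℂ,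
    ∃ u ∈ Matrix.specialUnitaryGroup (Fin 4) ℂ,
      (∃ (h : ℝ) (χ : ℂ), uR * φ * uLᴴ = !![(h : ℂ), 0; 0, χ]) ∧
      (∃ a b c : ℝ, uR * Δ * uᵀ = !![(a : ℂ), 0, 0, 0; (b : ℂ), (c : ℂ), 0, 0]) := by
  have hA : (φ * φᴴ).IsHermitian := isHermitian_mul_conjTranspose_self φ
  obtain ⟨W, hW, hdiag⟩ := diagLem _ hA
  obtain ⟨p, q, hp, hq, hdet, him⟩ := ex_phase_sq W.det ((W * (Δ * Δᴴ) * Wᴴ) 0 1) (det_unit hW)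
  have hd : diagonal ![p, q] ∈ unitaryGroup (Fin 2) ℂ := by
    apply mem_U_diag
    intro i; fin_cases i
    · exact hp
    · exact hq
  have conj : ∀ {n : ℕ} (X : Matrix (Fin 2) (Fin n) ℂ) (i j), 
      ((diagonal ![p, q] * W * X) * (diagonal ![p, q] * W * X)ᴴ) i j =
        ![p, q] i * (W * (X * Xᴴ) * Wᴴ) i j * star (![p, q] j) := by
    intro n X i j
    rw [← Pi.star_apply, ← diagonal_mul, ← mul_diagonal, ← diagonal_conjTranspose]
    simp only [conjTranspose_mul, Matrix.mul_assoc]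
  obtain ⟨uL, hL, e1⟩ := partφ (diagonal ![p, q] * W * φ) (by rw [conj, hdiag]; simp)
  obtain ⟨u, hu, e2⟩ := partΔ (diagonal ![p, q] * W * Δ) (by rw [conj]; simpa using him)
  refine ⟨diagonal ![p, q] * W, ?_, uL, hL, u, hu, e1, e2⟩
  rw [mem_specialUnitaryGroup_iff]
  refine ⟨mul_mem hd hW, ?_⟩
  rw [det_mul, det_diagonal, Fin.prod_univ_two]
  simpa using hdet
end

section
/- Let w > 0 and μ, ν, λ_Σ, λ_H, λ_{HΣ} be real parameters, and define the potential P(h, χ, δ₀, δ₁, η) for h, δ₀, δ₁ ∈ ℝ, χ ∈ ℂ, η ∈ ℂ³ by P = −μ²(h² + |χ|²) − ν²((w+δ₀)² + δ₁² + |η|²)²/w² + λ_Σ (h⁴ + |χ|⁴) + λ_H ((w+δ₀)⁴ + 2(w+δ₀)² δ₁² + (δ₁² + |η|²)²)²/w⁴ + λ_{HΣ} ((w+δ₀)² h² + (δ₁² + |η|²)|χ|²)((w+δ₀)² + δ₁² + |η|²)/w². Then for real numbers v and x, the point (h, χ, δ₀, δ₁, η) = (v, x, 0, 0, 0) is a critical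 point of P (viewed as a smooth function of the real and imaginary parts of all its arguments) if and only if 2v (w² λ_{HΣ} + 2 v² λ_Σ − μ²) = 0, 4 x³ λ_Σ − 2 x μ² = 0, and 4w (2 w² λ_H + v² λ_{HΣ} − ν²) = 0. -/
/-- Critical-point equations for the scalar potential of the composite
spectral Pati–Salam model (with ρ = 1) in unitary gauge: the point
`(h, χ, δ₀, δ₁, η) = (v, x, 0, 0, 0)` is a critical point of the potential
`P` if and only if the three stated equations hold. -/
theorem stmt_13 (w μ ν lS lH lHS : ℝ) (hw : 0 < w) (v x : ℝ)
    (P : ℝ × ℂ × ℝ × ℝ × (Fin 3 → ℂ) → ℝ)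
    (hP : P = fun p =>
      -μ ^ 2 * (p.1 ^ 2 + Complex.normSq p.2.1)
      - ν ^ 2 * ((w + p.2.2.1) ^ 2 + p.2.2.2.1 ^ 2 +
          ∑ i, Complex.normSq (p.2.2.2.2 i)) ^ 2 / w ^ 2
      + lS * (p.1 ^ 4 + Complex.normSq p.2.1 ^ 2)
      + lH * ((w + p.2.2.1) ^ 4 + 2 * (w + p.2.2.1) ^ 2 * p.2.2.2.1 ^ 2 +
          (p.2.2.2.1 ^ 2 + ∑ i, Complex.normSq (p.2.2.2.2 i)) ^ 2) ^ 2 / w ^ 4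
      + lHS * ((w + p.2.2.1) ^ 2 * p.1 ^ 2 +
          (p.2.2.2.1 ^ 2 + ∑ i, Complex.normSq (p.2.2.2.2 i)) * Complex.normSq p.2.1) *
          ((w + p.2.2.1) ^ 2 + p.2.2.2.1 ^ 2 + ∑ i, Complex.normSq (p.2.2.2.2 i)) / w ^ 2) :
    fderiv ℝ P (v, (x : ℂ), 0, 0, 0) = 0 ↔
      (2 * v * (w ^ 2 * lHS + 2 * v ^ 2 * lS - μ ^ 2) = 0 ∧
       4 * x ^ 3 * lS - 2 * x * μ ^ 2 = 0 ∧
       4 * w * (2 * w ^ 2 * lH + v ^ 2 * lHS - ν ^ 2) = 0) := by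
  have hd : DifferentiableAt ℝ P (v, (x : ℂ), 0, 0, 0) := by
    rw [hP]
    simp only [Complex.normSq_eq_norm_sq]
    have e : ∀ z : ℂ, ‖z‖ ^ 2 = z.re * z.re + z.im * z.im := fun z => by
      rw [← Complex.normSq_eq_norm_sq, Complex.normSq_apply]
    simp only [e, ← Complex.reCLM_apply, ← Complex.imCLM_apply]
    fun_prop
  have key : ∀ (a : ℝ) (c : ℂ) (d e : ℝ) (f : Fin 3 → ℂ),
      fderiv ℝ P (v, (x : ℂ), 0, 0, 0) (a, c, d, e, f) =
        a * (2 * v * (w ^ 2 * lHS + 2 * v ^ 2 * lS - μ ^ 2)) +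
        c.re * (4 * x ^ 3 * lS - 2 * x * μ ^ 2) +
        d * (4 * w * (2 * w ^ 2 * lH + v ^ 2 * lHS - ν ^ 2)) := by
    intro a c d e f
    have h1 := hd.hasFDerivAt.hasLineDerivAt (a, c, d, e, f)
    unfold HasLineDerivAt at h1
    refine h1.unique ?_
    have hH : HasDerivAt (fun t : ℝ => v + t * a) a 0 := by
      simpa using ((hasDerivAt_id (0 : ℝ)).mul_const a).const_add v
    have hD : HasDerivAt (fun t : ℝ => w + t * d) d 0 := by
      simpa using ((hasDerivAt_id (0 : ℝ)).mul_const d).const_add w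
    have hE : HasDerivAt (fun t : ℝ => t * e) e 0 := by
      simpa using ((hasDerivAt_id (0 : ℝ)).mul_const e)
    have hR : HasDerivAt (fun t : ℝ => x + t * c.re) c.re 0 := by
      simpa using ((hasDerivAt_id (0 : ℝ)).mul_const c.re).const_add x
    have hI : HasDerivAt (fun t : ℝ => t * c.im) c.im 0 := by
      simpa using ((hasDerivAt_id (0 : ℝ)).mul_const c.im)
    have hN : HasDerivAt (fun t : ℝ => (x + t * c.re) ^ 2 + (t * c.im) ^ 2) (2 * x * c.re) 0 := by
      refine ((hR.fun_pow 2).fun_add (hI.fun_pow 2)).congr_deriv ?_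
      simp
    have hS : HasDerivAt (fun t : ℝ => t ^ 2 * ∑ i, Complex.normSq (f i)) 0 0 := by
      simpa using ((hasDerivAt_id (0 : ℝ)).fun_pow 2).mul_const (∑ i, Complex.normSq (f i))
    have T1 := ((hH.fun_pow 2).fun_add hN).const_mul (-μ ^ 2)
    have hDE := ((hD.fun_pow 2).fun_add (hE.fun_pow 2)).fun_add hS
    have T2 := ((hDE.fun_pow 2).const_mul (ν ^ 2)).div_const (w ^ 2)
    have T3 := ((hH.fun_pow 4).fun_add (hN.fun_pow 2)).const_mul lS
    have hES := (hE.fun_pow 2).fun_add hS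
    have T4 := ((((((hD.fun_pow 4).fun_add (((hD.fun_pow 2).const_mul 2).fun_mul
      (hE.fun_pow 2))).fun_add (hES.fun_pow 2)).fun_pow 2)).const_mul lH).div_const (w ^ 4)
    have T5 := (((((hD.fun_pow 2).fun_mul (hH.fun_pow 2)).fun_add
      (hES.fun_mul hN)).const_mul lHS).fun_mul hDE).div_const (w ^ 2)
    have T := (((T1.fun_sub T2).fun_add T3).fun_add T4).fun_add T5
    refine (T.congr_deriv ?_).congr_of_eventuallyEq (Filter.Eventually.of_forall ?_)
    · have := hw.ne'
      simp
      field_simp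
      ring
    · intro t
      have n1 : Complex.normSq ((x : ℂ) + t * c) = (x + t * c.re) ^ 2 + (t * c.im) ^ 2 := by
        rw [Complex.normSq_apply]; simp; ring
      have n2 : ∑ i, Complex.normSq ((t : ℂ) * f i) = t ^ 2 * ∑ i, Complex.normSq (f i) := by
        rw [Finset.mul_sum]; simp [sq]
      rw [hP]
      simp only [Prod.smul_mk, Prod.mk_add_mk, zero_add, smul_eq_mul, Pi.smul_apply,
        Complex.real_smul, n1, n2]
  constructor
  · intro h
    rw [h] at key
    refine ⟨?_, ?_, ?_⟩
    · simpa using (key 1 0 0 0 0).symm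
    · have := key 0 1 0 0 0
      simp only [Complex.one_re, ContinuousLinearMap.zero_apply] at this
      linarith
    · have := key 0 0 1 0 0
      simp only [Complex.zero_re, ContinuousLinearMap.zero_apply] at this
      linarith
  · rintro ⟨h1, h2, h3⟩
    refine ContinuousLinearMap.ext ?_
    rintro ⟨a, c, d, e, f⟩
    rw [key, h1, h2, h3]
    simp
end
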